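/- For every integer t ≥ 1 there exists n_0 such that for all n ≥ n_0: ex_3(n, F_5(f_3;t)) = e(T_3(n,3)^{t+}). -/

import Mathlib

open Finset

/-- `H` (a 3-graph given by its edge set on vertex type `V`) contains a copy of the
3-graph `F` (given by its edge set on vertex type `W`). -/
def HasCopy {V W : Type*} [DecidableEq V] [DecidableEq W]
    (H : Finset (Finset V)) (F : Finset (Finset W)) : Prop :=
  ∃ f : W ↪ V, ∀ e ∈ F, e.image f ∈ H

/-- The Turán number `ex_3(n, F)`: the maximum number of hyperedges of an `F`-free
3-uniform hypergraph on `n` vertices. -/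
noncomputable def exThree {W : Type*} [DecidableEq W] (n : ℕ) (F : Finset (Finset W)) : ℕ :=
  sSup {k | ∃ H : Finset (Finset (Fin n)), (∀ e ∈ H, e.card = 3) ∧ ¬ HasCopy H F ∧ H.card = k}

/-- The `i`-th part of the balanced tripartition of `Fin n` (vertices with residue `i` mod 3);
the parts have sizes `⌊n/3⌋` or `⌈n/3⌉`. -/
def turanPart (n : ℕ) (i : Fin 3) : Finset (Fin n) :=
  Finset.univ.filter (fun v => (v : ℕ) % 3 = (i : ℕ))

/-- The balanced complete tripartite 3-graph `T_3(n,3)`: hyperedges are exactly the triples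
with one vertex in each part of the balanced tripartition. -/
def T3 (n : ℕ) : Finset (Finset (Fin n)) :=
  Finset.univ.filter (fun e => e.card = 3 ∧ ∀ i : Fin 3, (e ∩ turanPart n i).card = 1)

/-- The 3-graph `F_5` on `{f_1, …, f_5}` with hyperedges `f_1f_2f_3, f_1f_2f_4, f_3f_4f_5`. -/
def F5 : Finset (Finset (Fin 5)) := {{0,1,2},{0,1,3},{2,3,4}}

/-- `F_5(f_5;t)`: `F_5` with the vertex `f_5` blown up to `t` copies.
Here `inl 0, inl 1, inl 2, inl 3` play the roles of `f_1,f_2,f_3,f_4` and the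
vertices `inr j` are the `t` copies of `f_5`. -/
def F5b5 (t : ℕ) : Finset (Finset (Fin 4 ⊕ Fin t)) :=
  ({({Sum.inl 0, Sum.inl 1, Sum.inl 2} : Finset (Fin 4 ⊕ Fin t)),
    ({Sum.inl 0, Sum.inl 1, Sum.inl 3} : Finset (Fin 4 ⊕ Fin t))} :
      Finset (Finset (Fin 4 ⊕ Fin t))) ∪
  Finset.univ.image (fun j : Fin t => ({Sum.inl 2, Sum.inl 3, Sum.inr j} : Finset (Fin 4 ⊕ Fin t)))

/-- `F_5(f_3;t)`: `F_5` with the vertex `f_3` blown up to `t` copies.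
Here `inl 0, inl 1, inl 2, inl 3` play the roles of `f_1,f_2,f_4,f_5` and the
vertices `inr j` are the `t` copies of `f_3`. -/
def F5b3 (t : ℕ) : Finset (Finset (Fin 4 ⊕ Fin t)) :=
  ({({Sum.inl 0, Sum.inl 1, Sum.inl 2} : Finset (Fin 4 ⊕ Fin t))} :
      Finset (Finset (Fin 4 ⊕ Fin t))) ∪
  Finset.univ.image (fun j : Fin t => ({Sum.inl 0, Sum.inl 1, Sum.inr j} : Finset (Fin 4 ⊕ Fin t))) ∪
  Finset.univ.image (fun j : Fin t => ({Sum.inr j, Sum.inl 2, Sum.inl 3} : Finset (Fin 4 ⊕ Fin t)))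

/-- `S^t(N)` (the size of `D(N,3,t,2)`): the maximum number of hyperedges of a 3-graph on `N`
vertices in which every pair of vertices is contained in at most `t-1` hyperedges. -/
noncomputable def Dmax (N t : ℕ) : ℕ :=
  sSup {k | ∃ H : Finset (Finset (Fin N)), (∀ e ∈ H, e.card = 3) ∧
    (∀ u v : Fin N, u ≠ v → (H.filter (fun e => u ∈ e ∧ v ∈ e)).card ≤ t - 1) ∧ H.card = k}

/-- `e(T_3(n,3)^{t+})`: the number of hyperedges of `T_3(n,3)` together with a maximum
3-graph inside each part in which every pair of vertices lies in at most `t-1` hyperedges. -/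
noncomputable def eT3plus (n t : ℕ) : ℕ :=
  (T3 n).card + ∑ i : Fin 3, Dmax ((turanPart n i).card) t

/-- `F` is a subgraph of a blow-up of `F_5`: every edge is a triple, and there is a map
to `V(F_5)` that is injective on each edge and sends each edge to an edge of `F_5`. -/
def IsSubBlowupF5 {W : Type*} [DecidableEq W] (F : Finset (Finset W)) : Prop :=
  (∀ e ∈ F, e.card = 3) ∧ ∃ φ : W → Fin 5, ∀ e ∈ F, (e.image φ).card = 3 ∧ e.image φ ∈ F5

/-- The complete tripartite 3-graph with parts `A`, `B`, `C`: all triples with exactly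
one vertex in each of `A`, `B`, `C`. -/
def tripartiteEdges {n : ℕ} (A B C : Finset (Fin n)) : Finset (Finset (Fin n)) :=
  Finset.univ.filter (fun e =>
    (e ∩ A).card = 1 ∧ (e ∩ B).card = 1 ∧ (e ∩ C).card = 1 ∧ e.card = 3)

/-- The complete 3-partite 3-graph `K_{t,s,s}` with parts of sizes `t`, `s`, `s`. -/
def Ktss (t s : ℕ) : Finset (Finset (Fin t ⊕ Fin s ⊕ Fin s)) :=
  Finset.univ.image (fun x : Fin t × Fin s × Fin s =>
    ({Sum.inl x.1, Sum.inr (Sum.inl x.2.1), Sum.inr (Sum.inr x.2.2)} :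
      Finset (Fin t ⊕ Fin s ⊕ Fin s)))

/-- All hyperedges of `H` consist of one vertex of the `A`-side (`Fin mA`) and two
vertices of the `B`-side (`Fin nB`). -/
def BipShape (mA nB : ℕ) (H : Finset (Finset (Fin mA ⊕ Fin nB))) : Prop :=
  ∀ e ∈ H, ∃ a : Fin mA, ∃ b c : Fin nB, b ≠ c ∧
    e = ({Sum.inl a, Sum.inr b, Sum.inr c} : Finset (Fin mA ⊕ Fin nB))

/-- `H` contains a copy of `K_{t,s,s}` whose `t`-vertex part lies on the `A`-side and whose
two `s`-vertex parts lie on the `B`-side. -/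
def HasBipKtss (mA nB t s : ℕ) (H : Finset (Finset (Fin mA ⊕ Fin nB))) : Prop :=
  ∃ (T : Finset (Fin mA)) (S0 S1 : Finset (Fin nB)), T.card = t ∧
    S0.card = s ∧ S1.card = s ∧ Disjoint S0 S1 ∧
    ∀ a ∈ T, ∀ b ∈ S0, ∀ c ∈ S1,
      ({Sum.inl a, Sum.inr b, Sum.inr c} : Finset (Fin mA ⊕ Fin nB)) ∈ H

/-- The bipartite Turán number `ex_3^{bip}(mA, nB, K_{t,s,s})`. -/
noncomputable def exBip (mA nB t s : ℕ) : ℕ :=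
  sSup {k | ∃ H : Finset (Finset (Fin mA ⊕ Fin nB)),
    BipShape mA nB H ∧ ¬ HasBipKtss mA nB t s H ∧ H.card = k}

/-- The `s`-set `S_0` inside the residue-0 part of `T_3(3m,3)`. -/
def S0set (m s : ℕ) (h : 2*s ≤ m) : Finset (Fin (3*m)) :=
  Finset.univ.image (fun i : Fin s => (⟨3*i.val, by have := i.isLt; omega⟩ : Fin (3*m)))

/-- The `s`-set `S_1` inside the residue-0 part of `T_3(3m,3)`, disjoint from `S_0`. -/
def S1set (m s : ℕ) (h : 2*s ≤ m) : Finset (Fin (3*m)) :=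
  Finset.univ.image (fun i : Fin s => (⟨3*(s+i.val), by have := i.isLt; omega⟩ : Fin (3*m)))

/-- The 3-graph `F_5^S(m,t,K_{s,s})`: `T_3(3m,3)` (on the `inl` vertices) together with a set
`T` of `t` new vertices (the `inr` vertices) and all triples consisting of one vertex of `T`,
one vertex of `S_0` and one vertex of `S_1`. -/
def F5Stss (m t s : ℕ) (h : 2*s ≤ m) : Finset (Finset (Fin (3*m) ⊕ Fin t)) :=
  (T3 (3*m)).image (fun e => e.image Sum.inl) ∪
  Finset.univ.biUnion (fun j : Fin t =>
    ((S0set m s h) ×ˢ (S1set m s h)).image (fun p =>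
      ({Sum.inr j, Sum.inl p.1, Sum.inl p.2} : Finset (Fin (3*m) ⊕ Fin t))))

/-- `F_sim(t)`: the 3-graph with hyperedges `f_1f_2f_3, f_1f_2f_4, f_3f_4f_5, f_5f_6f_7,
f_6f_7f_8` in which `f_8` is blown up to `t` copies. Here `inl 0, …, inl 6` play the roles
of `f_1, …, f_7` and the vertices `inr j` are the `t` copies of `f_8`. -/
def Fsim (t : ℕ) : Finset (Finset (Fin 7 ⊕ Fin t)) :=
  ({({Sum.inl 0, Sum.inl 1, Sum.inl 2} : Finset (Fin 7 ⊕ Fin t)),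
    ({Sum.inl 0, Sum.inl 1, Sum.inl 3} : Finset (Fin 7 ⊕ Fin t)),
    ({Sum.inl 2, Sum.inl 3, Sum.inl 4} : Finset (Fin 7 ⊕ Fin t)),
    ({Sum.inl 4, Sum.inl 5, Sum.inl 6} : Finset (Fin 7 ⊕ Fin t))} :
      Finset (Finset (Fin 7 ⊕ Fin t))) ∪
  Finset.univ.image (fun j : Fin t => ({Sum.inl 5, Sum.inl 6, Sum.inr j} : Finset (Fin 7 ⊕ Fin t)))

/-- The 3-graph with parts `A`, `B`, `C` and an extra clique `X`: its hyperedges are the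
triples with one vertex in each of `A`, `B`, `C`, all 3-subsets of `X`, and the triples with
one vertex in `X` and two vertices in a common part among `A`, `B`, `C`. -/
def simConstr (n : ℕ) (A B C X : Finset (Fin n)) : Finset (Finset (Fin n)) :=
  Finset.univ.filter (fun e => e.card = 3 ∧
    (((e ∩ A).card = 1 ∧ (e ∩ B).card = 1 ∧ (e ∩ C).card = 1) ∨
     e ⊆ X ∨
     ((e ∩ X).card = 1 ∧ ((e ∩ A).card = 2 ∨ (e ∩ B).card = 2 ∨ (e ∩ C).card = 2))))

/-- `F_5^S(m)`: `T_3(3m,3)` together with one new vertex `v = inr ()` and one hyperedge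
consisting of `v` and two vertices (`0` and `3`) lying in one part of `T_3(3m,3)`. -/
def F5Sm (m : ℕ) (hm : 2 ≤ m) : Finset (Finset (Fin (3*m) ⊕ Unit)) :=
  (T3 (3*m)).image (fun e => e.image Sum.inl) ∪
  {({Sum.inr (), Sum.inl ⟨0, by omega⟩, Sum.inl ⟨3, by omega⟩} : Finset (Fin (3*m) ⊕ Unit))}

/-- The disjoint union of `k` vertex-disjoint copies of the 3-graph `F`. -/
def copies (k : ℕ) {W : Type*} [DecidableEq W] (F : Finset (Finset W)) :
    Finset (Finset (Fin k × W)) :=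
  Finset.univ.biUnion (fun j : Fin k => F.image (fun e => e.image (fun w => (j, w))))

/-- The 3-graph `G(t,m,n)` (it does not depend on `m`): the vertices `v < t` form the set
`T`, the remaining `n - t` vertices carry a copy of `T_3(n-t,3)` (parts by residue of
`v - t` mod 3), and the hyperedges are those of this `T_3(n-t,3)` together with all
3-sets of vertices intersecting `T`. -/
def Gtmn (t n : ℕ) : Finset (Finset (Fin n)) :=
  Finset.univ.filter (fun e => e.card = 3 ∧
    ((∃ v ∈ e, (v : ℕ) < t) ∨
     (∀ i : Fin 3, (e.filter (fun v : Fin n => t ≤ (v : ℕ) ∧ ((v : ℕ) - t) % 3 = (i : ℕ))).card = 1)))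

/-- The blow-up of `F_5` in which every vertex is replaced by `t` copies:
the vertex `(i, j)` is the `j`-th copy of `f_{i+1}`. -/
def F5blowAll (t : ℕ) : Finset (Finset (Fin 5 × Fin t)) :=
  Finset.univ.biUnion (fun x : Fin t × Fin t × Fin t =>
    ({ ({((0:Fin 5), x.1), ((1:Fin 5), x.2.1), ((2:Fin 5), x.2.2)} : Finset (Fin 5 × Fin t)),
       ({((0:Fin 5), x.1), ((1:Fin 5), x.2.1), ((3:Fin 5), x.2.2)} : Finset (Fin 5 × Fin t)),
       ({((2:Fin 5), x.1), ((3:Fin 5), x.2.1), ((4:Fin 5), x.2.2)} : Finset (Fin 5 × Fin t)) } :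
      Finset (Finset (Fin 5 × Fin t))))

section LinkCounting

variable {V : Type*} [Fintype V] [DecidableEq V]

/-- The vertices completing the pair `u, v` to a hyperedge of `H`. -/
def conbr (H : Finset (Finset V)) (u v : V) : Finset V :=
  Finset.univ.filter fun w => ({u, v, w} : Finset V) ∈ H

/-- The number of ordered pairs in `A × B` forming a hyperedge of `H` with `c`. -/
def linkCount (H : Finset (Finset V)) (c : V) (A B : Finset V) : ℕ :=
  ∑ x ∈ A, (conbr H c x ∩ B).card

/-- The number of ordered triples in `A × B × C` forming a hyperedge of `H`. -/
def tripleCount (H : Finset (Finset V)) (A B C : Finset V) : ℕ :=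
  ∑ a ∈ A, linkCount H a B C

/-- All hyperedges have three vertices. -/
def IsUniformThree (H : Finset (Finset V)) : Prop := ∀ e ∈ H, e.card = 3

/-- A local reformulation of being free of `F_5(f_3;t)`. -/
def IsBlowFree (t : ℕ) (H : Finset (Finset V)) : Prop :=
  ∀ a b c d : V, ({a, b, c} : Finset V) ∈ H → d ≠ a → d ≠ b →
    (conbr H a b ∩ conbr H c d).card < t

variable {H : Finset (Finset V)}

lemma mem_conbr {u v w : V} : w ∈ conbr H u v ↔ ({u, v, w} : Finset V) ∈ H := by
  simp [conbr]

lemma mem_conbr_swap {u v w : V} : w ∈ conbr H u v ↔ v ∈ conbr H u w := by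
  rw [mem_conbr, mem_conbr, Finset.pair_comm v w]

lemma conbr_comm (u v : V) : conbr H u v = conbr H v u := by
  ext w; rw [mem_conbr, mem_conbr, Finset.insert_comm]

lemma IsUniformThree.distinct (hH : IsUniformThree H) {a b c : V}
    (h : ({a, b, c} : Finset V) ∈ H) : a ≠ b ∧ a ≠ c ∧ b ≠ c := by
  have h3 := hH _ h
  refine ⟨?_, ?_, ?_⟩ <;> rintro rfl
  · have : ({a, a, c} : Finset V).card ≤ 2 := by
      rw [Finset.insert_idem]; exact Finset.card_le_two
    omega
  · have : ({a, b, a} : Finset V).card ≤ 2 := by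
      rw [Finset.pair_comm, Finset.insert_idem]; exact Finset.card_le_two
    omega
  · have : ({a, b, b} : Finset V).card ≤ 2 := by
      rw [Finset.pair_eq_singleton]; exact Finset.card_le_two
    omega

lemma sum_card_inter_filter_comm {α β : Type*} [DecidableEq α] [DecidableEq β]
    (A : Finset α) (B : Finset β)
    (f : α → Finset β) (g : β → Finset α) (h : ∀ a b, b ∈ f a ↔ a ∈ g b) :
    ∑ a ∈ A, (f a ∩ B).card = ∑ b ∈ B, (g b ∩ A).card := by
  have h1 : ∀ a, (f a ∩ B).card = ∑ b ∈ B, if b ∈ f a then 1 else 0 := by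
    intro a
    rw [Finset.inter_comm, ← Finset.filter_mem_eq_inter, Finset.card_filter]
  have h2 : ∀ b, (g b ∩ A).card = ∑ a ∈ A, if a ∈ g b then 1 else 0 := by
    intro b
    rw [Finset.inter_comm, ← Finset.filter_mem_eq_inter, Finset.card_filter]
  simp_rw [h1, h2, h]
  exact Finset.sum_comm

lemma linkCount_comm (c : V) (A B : Finset V) : linkCount H c A B = linkCount H c B A :=
  sum_card_inter_filter_comm A B _ _ fun _ _ => mem_conbr_swap

lemma linkCount_union_right (c : V) (A : Finset V) {B C : Finset V} (h : Disjoint B C) :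
    linkCount H c A (B ∪ C) = linkCount H c A B + linkCount H c A C := by
  unfold linkCount
  rw [← Finset.sum_add_distrib]
  refine Finset.sum_congr rfl fun x _ => ?_
  rw [Finset.inter_union_distrib_left, Finset.card_union_of_disjoint]
  exact h.mono Finset.inter_subset_right Finset.inter_subset_right

lemma linkCount_union_left (c : V) {A B : Finset V} (C : Finset V) (h : Disjoint A B) :
    linkCount H c (A ∪ B) C = linkCount H c A C + linkCount H c B C :=
  Finset.sum_union h

lemma linkCount_mono (c : V) {A A' B B' : Finset V} (hA : A ⊆ A') (hB : B ⊆ B') :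
    linkCount H c A B ≤ linkCount H c A' B' :=
  (Finset.sum_le_sum fun _ _ => Finset.card_le_card (Finset.inter_subset_inter_left hB)).trans
    (Finset.sum_le_sum_of_subset hA)

lemma linkCount_le_mul (c : V) (A B : Finset V) : linkCount H c A B ≤ A.card * B.card := by
  unfold linkCount
  rw [← smul_eq_mul]
  exact Finset.sum_le_card_nsmul _ _ _ fun x _ => Finset.card_le_card Finset.inter_subset_right

lemma linkCount_le_of_codegree (c : V) (A B : Finset V) {s : ℕ}
    (h : ∀ x ∈ A, (conbr H c x ∩ B).card ≤ s) : linkCount H c A B ≤ A.card * s := by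
  unfold linkCount
  rw [← smul_eq_mul]
  exact Finset.sum_le_card_nsmul _ _ _ h

lemma tripleCount_rotate (A B C : Finset V) : tripleCount H A B C = tripleCount H B C A := by
  have : ∀ A B C : Finset V, tripleCount H A B C = ∑ b ∈ B, ∑ a ∈ A, (conbr H a b ∩ C).card := by
    intro A B C
    unfold tripleCount linkCount
    exact Finset.sum_comm
  rw [this]
  unfold tripleCount
  refine Finset.sum_congr rfl fun b _ => ?_
  rw [linkCount_comm]
  unfold linkCount
  refine Finset.sum_congr rfl fun a _ => ?_
  rw [conbr_comm]

lemma IsUniformThree.linkCount_erase (hH : IsUniformThree H) (v : V) (A B : Finset V) :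
    linkCount H v (A.erase v) B = linkCount H v A B := by
  unfold linkCount
  refine Finset.sum_subset (Finset.erase_subset _ _) fun x hx hx' => ?_
  have : x = v := by
    by_contra h; exact hx' (Finset.mem_erase.2 ⟨h, hx⟩)
  subst this
  rw [Finset.card_eq_zero, Finset.eq_empty_iff_forall_notMem]
  intro y hy
  exact (hH.distinct (mem_conbr.1 (Finset.mem_inter.1 hy).1)).1 rfl

lemma IsUniformThree.linkCount_univ (hH : IsUniformThree H) (v : V) :
    linkCount H v univ univ = 2 * (H.filter (v ∈ ·)).card := by
  have h1 : linkCount H v univ univ =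
      ((univ : Finset (V × V)).filter fun p => ({v, p.1, p.2} : Finset V) ∈ H).card := by
    rw [Finset.card_filter, ← Finset.univ_product_univ, Finset.sum_product]
    unfold linkCount
    refine Finset.sum_congr rfl fun x _ => ?_
    rw [Finset.inter_univ, conbr, Finset.card_filter]
  rw [h1, Finset.card_eq_sum_card_fiberwise (f := fun p : V × V => ({v, p.1, p.2} : Finset V))
    (t := H.filter (v ∈ ·))]
  · rw [mul_comm, ← smul_eq_mul]
    refine Finset.sum_const_nat fun e he => ?_
    obtain ⟨heH, hve⟩ := Finset.mem_filter.1 he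
    obtain ⟨x, y, z, hxy, hxz, hyz, rfl⟩ := Finset.card_eq_three.1 (hH e heH)
    have key : ∀ a b : V, v ≠ a → v ≠ b → a ≠ b → ({v, a, b} : Finset V) ∈ H →
        ((univ.filter fun p : V × V => ({v, p.1, p.2} : Finset V) ∈ H).filter
          fun p => ({v, p.1, p.2} : Finset V) = {v, a, b}).card = 2 := by
      intro a b hva hvb hab hm
      have : ((univ.filter fun p : V × V => ({v, p.1, p.2} : Finset V) ∈ H).filter
          fun p => ({v, p.1, p.2} : Finset V) = {v, a, b}) = {(a, b), (b, a)} := by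
        ext ⟨p, q⟩
        simp only [Finset.mem_filter, Finset.mem_univ, true_and, Finset.mem_insert,
          Finset.mem_singleton, Prod.mk.injEq]
        constructor
        · rintro ⟨h, h'⟩
          obtain ⟨d1, d2, d3⟩ := hH.distinct h
          have hp : p ∈ ({v, a, b} : Finset V) := by rw [← h']; simp
          have hq : q ∈ ({v, a, b} : Finset V) := by rw [← h']; simp
          simp only [Finset.mem_insert, Finset.mem_singleton] at hp hq
          grind
        · rintro (⟨rfl, rfl⟩ | ⟨rfl, rfl⟩)
          · exact ⟨hm, rfl⟩
          · rw [Finset.pair_comm]; exact ⟨hm, rfl⟩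
      rw [this, Finset.card_pair]
      simp [hab]
    simp only [Finset.mem_insert, Finset.mem_singleton] at hve
    rcases hve with rfl | rfl | rfl
    · exact key _ _ hxy hxz hyz heH
    · rw [Finset.insert_comm] at heH ⊢
      exact key _ _ hxy.symm hyz hxz heH
    · rw [Finset.pair_comm, Finset.insert_comm] at heH ⊢
      exact key _ _ hxz.symm hyz.symm hxy heH
  · intro p hp
    have := (Finset.mem_filter.1 hp).2
    simp [this]

lemma IsUniformThree.sum_linkCount (hH : IsUniformThree H) :
    ∑ v, linkCount H v univ univ = 6 * H.card := by
  simp_rw [hH.linkCount_univ, ← Finset.mul_sum, Finset.card_filter]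
  rw [Finset.sum_comm]
  have : ∑ e ∈ H, ∑ v : V, (if v ∈ e then 1 else 0) = H.card * 3 := by
    refine Finset.sum_const_nat fun e he => ?_
    rw [← hH e he, ← Finset.card_filter]
    congr 1; ext; simp
  rw [this]; ring

lemma IsUniformThree.card_filter_pair (hH : IsUniformThree H) {u v : V} (huv : u ≠ v) :
    (H.filter fun e => u ∈ e ∧ v ∈ e).card = (conbr H u v).card := by
  symm
  refine Finset.card_bij (fun w _ => {u, v, w}) ?_ ?_ ?_
  · intro w hw
    simp [mem_conbr.1 hw]
  · intro w hw w' hw' h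
    have h1 := hH.distinct (mem_conbr.1 hw)
    have : w ∈ ({u, v, w'} : Finset V) := by rw [← h]; simp
    simp only [Finset.mem_insert, Finset.mem_singleton] at this
    grind
  · intro e he
    obtain ⟨heH, hu, hv⟩ := Finset.mem_filter.1 he
    have h2 : ((e.erase u).erase v).card = 1 := by
      rw [Finset.card_erase_of_mem (Finset.mem_erase.2 ⟨huv.symm, hv⟩),
        Finset.card_erase_of_mem hu, hH e heH]
    obtain ⟨w, hw⟩ := Finset.card_eq_one.1 h2
    have : e = {u, v, w} := by
      rw [← Finset.insert_erase hu, ← Finset.insert_erase (Finset.mem_erase.2 ⟨huv.symm, hv⟩), hw]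
    refine ⟨w, ?_, this.symm⟩
    rw [mem_conbr, ← this]; exact heH

end LinkCounting

lemma card_filter_map_pair {V W : Type*} [DecidableEq V] [DecidableEq W] (g : W ↪ V)
    (G : Finset (Finset W)) (u v : W) :
    ((G.map ⟨fun e => e.map g, Finset.map_injective g⟩).filter
      fun e => g u ∈ e ∧ g v ∈ e).card = (G.filter fun e => u ∈ e ∧ v ∈ e).card := by
  rw [Finset.filter_map, Finset.card_map]
  congr 1
  ext e
  simp

lemma bddAbove_card_finset {α : Type*} [Fintype α] (p : Finset α → Prop) :
    BddAbove {k | ∃ H : Finset α, p H ∧ H.card = k} :=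
  ⟨Fintype.card α, by rintro k ⟨H, -, rfl⟩; exact Finset.card_le_univ H⟩

lemma bddAbove_card_finset_and {α : Type*} [Fintype α] (p q : Finset α → Prop) :
    BddAbove {k | ∃ H : Finset α, p H ∧ q H ∧ H.card = k} := by
  simpa only [and_assoc] using bddAbove_card_finset fun H => p H ∧ q H

lemma card_le_Dmax_fin {N t : ℕ} {G : Finset (Finset (Fin N))} (hG : ∀ e ∈ G, e.card = 3)
    (hd : ∀ u v : Fin N, u ≠ v → (G.filter fun e => u ∈ e ∧ v ∈ e).card ≤ t - 1) :
    G.card ≤ Dmax N t :=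
  le_csSup (bddAbove_card_finset_and _ _) ⟨G, hG, hd, rfl⟩

lemma exists_card_eq_Dmax_fin (N t : ℕ) : ∃ G : Finset (Finset (Fin N)), (∀ e ∈ G, e.card = 3) ∧
    (∀ u v : Fin N, u ≠ v → (G.filter fun e => u ∈ e ∧ v ∈ e).card ≤ t - 1) ∧
    G.card = Dmax N t := by
  refine Nat.sSup_mem (s := {k | ∃ H : Finset (Finset (Fin N)), (∀ e ∈ H, e.card = 3) ∧
    (∀ u v : Fin N, u ≠ v → (H.filter (fun e => u ∈ e ∧ v ∈ e)).card ≤ t - 1) ∧ H.card = k})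
    ⟨0, ∅, by simp⟩ (bddAbove_card_finset_and _ _)

section Transport

variable {V : Type*} [DecidableEq V]

/-- An embedding of `Fin s.card` with range `s`. -/
noncomputable def finEmb (s : Finset V) : Fin s.card ↪ V :=
  s.equivFin.symm.toEmbedding.trans (Function.Embedding.subtype _)

lemma finEmb_mem (s : Finset V) (i : Fin s.card) : finEmb s i ∈ s :=
  (s.equivFin.symm i).2

lemma exists_finEmb_eq {s : Finset V} {v : V} (hv : v ∈ s) : ∃ i, finEmb s i = v :=
  ⟨s.equivFin ⟨v, hv⟩, by simp [finEmb]⟩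

/-- A design of maximum size inside any given vertex set. -/
lemma exists_card_eq_Dmax (s : Finset V) (t : ℕ) : ∃ G : Finset (Finset V),
    (∀ e ∈ G, e.card = 3) ∧ (∀ e ∈ G, e ⊆ s) ∧
    (∀ u v : V, u ≠ v → (G.filter fun e => u ∈ e ∧ v ∈ e).card ≤ t - 1) ∧
    G.card = Dmax s.card t := by
  obtain ⟨G, h3, hd, hc⟩ := exists_card_eq_Dmax_fin s.card t
  have hsub : ∀ e ∈ G.map ⟨fun e => e.map (finEmb s), Finset.map_injective _⟩, e ⊆ s := by
    intro e he
    obtain ⟨e, -, rfl⟩ := Finset.mem_map.1 he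
    intro v hv
    obtain ⟨i, -, rfl⟩ := Finset.mem_map.1 hv
    exact finEmb_mem _ _
  refine ⟨G.map ⟨fun e => e.map (finEmb s), Finset.map_injective _⟩, ?_, hsub, ?_, ?_⟩
  · intro e he
    obtain ⟨e, h, rfl⟩ := Finset.mem_map.1 he
    simpa using h3 e h
  · intro u v huv
    by_cases hs : u ∈ s ∧ v ∈ s
    · obtain ⟨i, rfl⟩ := exists_finEmb_eq hs.1
      obtain ⟨j, rfl⟩ := exists_finEmb_eq hs.2
      rw [card_filter_map_pair]
      exact hd i j fun h => huv (by rw [h])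
    · rw [Finset.filter_false_of_mem, Finset.card_empty]
      · omega
      · intro e he h
        exact hs ⟨hsub e he h.1, hsub e he h.2⟩
  · rw [Finset.card_map, hc]

lemma card_le_Dmax {s : Finset V} {t : ℕ} {G : Finset (Finset V)} (h3 : ∀ e ∈ G, e.card = 3)
    (hs : ∀ e ∈ G, e ⊆ s)
    (hd : ∀ u ∈ s, ∀ v ∈ s, u ≠ v → (G.filter fun e => u ∈ e ∧ v ∈ e).card ≤ t - 1) :
    G.card ≤ Dmax s.card t := by
  classical
  set g := finEmb s
  have himg : ∀ e ⊆ s, ∃ e' : Finset (Fin s.card), e'.map g = e := by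
    intro e he
    refine ⟨univ.filter fun i => g i ∈ e, ?_⟩
    ext v
    simp only [Finset.mem_map, Finset.mem_filter, Finset.mem_univ, true_and]
    constructor
    · rintro ⟨i, hi, rfl⟩; exact hi
    · intro hv
      obtain ⟨i, rfl⟩ := exists_finEmb_eq (he hv)
      exact ⟨i, hv, rfl⟩
  set G' : Finset (Finset (Fin s.card)) := univ.filter fun e => e.map g ∈ G
  have hG : G'.map ⟨fun e => e.map g, Finset.map_injective g⟩ = G := by
    ext e
    simp only [G', Finset.mem_map, Finset.mem_filter, Finset.mem_univ, true_and,
      Function.Embedding.coeFn_mk]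
    constructor
    · rintro ⟨e', h, rfl⟩; exact h
    · intro he
      obtain ⟨e', rfl⟩ := himg e (hs e he)
      exact ⟨e', he, rfl⟩
  rw [← hG, Finset.card_map]
  refine card_le_Dmax_fin ?_ ?_
  · intro e he
    simpa using h3 _ (Finset.mem_filter.1 he).2
  · intro i j hij
    rw [← card_filter_map_pair g, hG]
    exact hd _ (finEmb_mem _ _) _ (finEmb_mem _ _) fun h => hij (g.injective h)

end Transport

lemma Dmax_mono {N N' : ℕ} (h : N ≤ N') (t : ℕ) : Dmax N t ≤ Dmax N' t := by
  obtain ⟨s, -, rfl⟩ := Finset.exists_subset_card_eq (s := (univ : Finset (Fin N'))) (n := N)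
    (by simpa using h)
  obtain ⟨G, h3, -, hd, hc⟩ := exists_card_eq_Dmax s t
  rw [← hc]
  exact card_le_Dmax_fin h3 hd

lemma six_mul_Dmax_le (N t : ℕ) : 6 * Dmax N t ≤ (t - 1) * (N * (N - 1)) := by
  obtain ⟨G, h3, hd, hc⟩ := exists_card_eq_Dmax_fin N t
  have hG : IsUniformThree G := h3
  rw [← hc, ← hG.sum_linkCount]
  calc ∑ v, linkCount G v univ univ ≤ ∑ _v : Fin N, (N - 1) * (t - 1) := by
        refine Finset.sum_le_sum fun v _ => ?_
        rw [← hG.linkCount_erase]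
        refine (linkCount_le_of_codegree (s := t - 1) _ _ _ fun x hx => ?_).trans ?_
        · rw [Finset.inter_univ, ← hG.card_filter_pair (Finset.ne_of_mem_erase hx).symm]
          exact hd _ _ (Finset.ne_of_mem_erase hx).symm
        · rw [Finset.card_erase_of_mem (mem_univ _), Finset.card_univ, Fintype.card_fin]
    _ = (t - 1) * (N * (N - 1)) := by
        rw [Finset.sum_const, Finset.card_univ, Fintype.card_fin, smul_eq_mul]; ring

section Blow

variable {V : Type*} [Fintype V] [DecidableEq V] {H : Finset (Finset V)}

lemma mem_F5b3 {t : ℕ} {e : Finset (Fin 4 ⊕ Fin t)} : e ∈ F5b3 t ↔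
    e = {Sum.inl 0, Sum.inl 1, Sum.inl 2} ∨ (∃ j, {Sum.inl 0, Sum.inl 1, Sum.inr j} = e) ∨
    ∃ j, {Sum.inr j, Sum.inl 2, Sum.inl 3} = e := by
  simp [F5b3]

lemma isBlowFree_of_not_hasCopy {t : ℕ} (ht : 1 ≤ t) (hH : IsUniformThree H)
    (hc : ¬ HasCopy H (F5b3 t)) : IsBlowFree t H := by
  intro a b c d habc hda hdb
  by_contra hlt
  push Not at hlt
  obtain ⟨hab, hac, hbc⟩ := hH.distinct habc
  obtain ⟨S, hS, hSc⟩ := Finset.exists_subset_card_eq hlt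
  have hmem : ∀ x ∈ S, ({a, b, x} : Finset V) ∈ H ∧ ({c, d, x} : Finset V) ∈ H := by
    intro x hx
    have := hS hx
    rw [Finset.mem_inter, mem_conbr, mem_conbr] at this
    exact this
  have hcd : c ≠ d := by
    obtain ⟨x, hx⟩ : S.Nonempty := by rw [← Finset.card_pos]; omega
    exact (hH.distinct (hmem x hx).2).1
  refine hc ⟨⟨Sum.elim ![a, b, c, d] fun j => finEmb S (Fin.cast hSc.symm j), ?_⟩, ?_⟩
  · have hx : ∀ j, a ≠ finEmb S j ∧ b ≠ finEmb S j ∧ c ≠ finEmb S j ∧ d ≠ finEmb S j := by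
      intro j
      have h1 := hmem _ (finEmb_mem S j)
      have h2 := hH.distinct h1.1
      have h3 := hH.distinct h1.2
      exact ⟨h2.2.1, h2.2.2, h3.2.1, h3.2.2⟩
    refine Function.Injective.sumElim ?_ ?_ ?_
    · intro i j
      fin_cases i <;> fin_cases j <;> simp <;> grind
    · intro i j h
      simpa using h
    · intro i j
      fin_cases i <;> simp [hx]
  · intro e he
    rcases mem_F5b3.1 he with rfl | ⟨j, rfl⟩ | ⟨j, rfl⟩
    · simpa using habc
    · simpa using (hmem _ (finEmb_mem S (Fin.cast hSc.symm j))).1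
    · have := (hmem _ (finEmb_mem S (Fin.cast hSc.symm j))).2
      rw [Finset.pair_comm, Finset.insert_comm, Finset.pair_comm] at this
      simp only [Finset.image_insert, Finset.image_singleton, Function.Embedding.coeFn_mk,
        Sum.elim_inl, Sum.elim_inr]
      convert this using 2
      simp [Finset.pair_comm]

end Blow

lemma card_le_exThree {W : Type*} [DecidableEq W] {n : ℕ} {F : Finset (Finset W)}
    {H : Finset (Finset (Fin n))} (h3 : ∀ e ∈ H, e.card = 3) (hc : ¬ HasCopy H F) :
    H.card ≤ exThree n F :=
  le_csSup (bddAbove_card_finset_and _ _) ⟨H, h3, hc, rfl⟩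

lemma exists_card_eq_exThree {W : Type*} [DecidableEq W] (n : ℕ) {F : Finset (Finset W)}
    (hF : F.Nonempty) : ∃ H : Finset (Finset (Fin n)), (∀ e ∈ H, e.card = 3) ∧ ¬ HasCopy H F ∧
      H.card = exThree n F := by
  refine Nat.sSup_mem (s := {k | ∃ H : Finset (Finset (Fin n)), (∀ e ∈ H, e.card = 3) ∧
    ¬ HasCopy H F ∧ H.card = k}) ⟨0, ∅, by simp, ?_, rfl⟩ (bddAbove_card_finset_and _ _)
  rintro ⟨f, hf⟩
  obtain ⟨e, he⟩ := hF
  simpa using hf e he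

section Relation

variable {V : Type*} [Fintype V] [DecidableEq V]

/-- The 3-graph whose hyperedges are the triples satisfying `R`. -/
noncomputable def hyperOf (R : V → V → V → Prop) : Finset (Finset V) := by
  classical exact univ.filter fun e => ∃ x y z, e = {x, y, z} ∧ R x y z

/-- A symmetric ternary relation that only holds for distinct elements. -/
structure IsTripleRel (R : V → V → V → Prop) : Prop where
  swap_left : ∀ x y z, R x y z → R y x z
  swap_right : ∀ x y z, R x y z → R x z y
  distinct : ∀ x y z, R x y z → x ≠ y ∧ x ≠ z ∧ y ≠ z

variable {R : V → V → V → Prop}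

lemma IsTripleRel.of_mem (hR : IsTripleRel R) {x y z x' y' z' : V} (h : R x y z)
    (hx : x' = x ∨ x' = y ∨ x' = z) (hy : y' = x ∨ y' = y ∨ y' = z)
    (hz : z' = x ∨ z' = y ∨ z' = z) (hxy : x' ≠ y') (hxz : x' ≠ z') (hyz : y' ≠ z') :
    R x' y' z' := by
  have h1 := hR.swap_left _ _ _ h
  have h2 := hR.swap_right _ _ _ h
  have h3 := hR.swap_right _ _ _ h1
  have h4 := hR.swap_left _ _ _ h2
  have h5 := hR.swap_left _ _ _ h3
  rcases hx with rfl | rfl | rfl <;> rcases hy with rfl | rfl | rfl <;>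
    rcases hz with rfl | rfl | rfl <;> first | contradiction | assumption

lemma IsTripleRel.isUniformThree (hR : IsTripleRel R) : IsUniformThree (hyperOf R) := by
  intro e he
  simp only [hyperOf, Finset.mem_filter, Finset.mem_univ, true_and] at he
  obtain ⟨x, y, z, rfl, h⟩ := he
  obtain ⟨h1, h2, h3⟩ := hR.distinct _ _ _ h
  exact Finset.card_eq_three.2 ⟨x, y, z, h1, h2, h3, rfl⟩

lemma IsTripleRel.mem_hyperOf (hR : IsTripleRel R) {x y z : V} :
    ({x, y, z} : Finset V) ∈ hyperOf R ↔ R x y z := by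
  constructor
  · intro h
    obtain ⟨d1, d2, d3⟩ := hR.isUniformThree.distinct h
    simp only [hyperOf, Finset.mem_filter, Finset.mem_univ, true_and] at h
    obtain ⟨x', y', z', he, h⟩ := h
    have hm : ∀ w ∈ ({x, y, z} : Finset V), w = x' ∨ w = y' ∨ w = z' := by
      intro w hw; rw [he] at hw; simpa using hw
    exact hR.of_mem h (hm _ (by simp)) (hm _ (by simp)) (hm _ (by simp)) d1 d2 d3
  · intro h
    simp only [hyperOf, Finset.mem_filter, Finset.mem_univ, true_and]
    exact ⟨x, y, z, rfl, h⟩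

lemma IsTripleRel.mem_conbr (hR : IsTripleRel R) {x y z : V} :
    z ∈ conbr (hyperOf R) x y ↔ R x y z := by
  rw [_root_.mem_conbr, hR.mem_hyperOf]

end Relation

section Design

variable {V : Type*} [Fintype V] [DecidableEq V] {H : Finset (Finset V)}

lemma IsUniformThree.card_le_Dmax (hH : IsUniformThree H) {t : ℕ}
    (hd : ∀ u v, u ≠ v → (conbr H u v).card ≤ t - 1) : H.card ≤ Dmax (Fintype.card V) t := by
  refine _root_.card_le_Dmax (s := univ) hH (fun e _ => Finset.subset_univ e) ?_
  intro u _ v _ huv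
  rw [hH.card_filter_pair huv]
  exact hd u v huv

/-- If all pairs outside `B` have codegree at least `k`, there are many hyperedges. -/
lemma IsUniformThree.mul_sq_le (hH : IsUniformThree H) {k : ℕ} (B : Finset (V × V))
    (hB : ∀ u v, (u, v) ∉ B → k ≤ (conbr H u v).card) :
    k * (Fintype.card V) ^ 2 ≤ 6 * H.card + k * B.card := by
  have h1 : 6 * H.card = ∑ p : V × V, (conbr H p.1 p.2).card := by
    rw [← hH.sum_linkCount, ← Finset.univ_product_univ, Finset.sum_product]
    simp [linkCount]
  have h2 : ∑ p : V × V, k ≤ ∑ p : V × V, ((conbr H p.1 p.2).card + if p ∈ B then k else 0) := by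
    refine Finset.sum_le_sum fun p _ => ?_
    split_ifs with hp
    · omega
    · exact hB p.1 p.2 hp
  rw [Finset.sum_add_distrib, ← h1, Finset.sum_const, Finset.card_univ, Fintype.card_prod,
    ← Finset.sum_filter, Finset.sum_const] at h2
  simp only [Finset.filter_mem_eq_inter, Finset.univ_inter, smul_eq_mul] at h2
  nlinarith

lemma conbr_union (G H : Finset (Finset V)) (u v : V) :
    conbr (G ∪ H) u v = conbr G u v ∪ conbr H u v := by
  ext w; simp [mem_conbr]

end Design

/-- A colouring of `ZMod m` making `x ↦ ε(x) - 2x` and `x ↦ (1 - ε(x)) - 2x` bijective. -/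
lemma exists_coloring_injective (m : ℕ) [NeZero m] : ∃ χ : ZMod m → Bool, ∀ b,
    Function.Injective fun x : ZMod m => ((xor (χ x) b).toNat : ZMod m) - 2 * x := by
  rcases Nat.even_or_odd' m with ⟨k, hk | hk⟩
  · refine ⟨fun x => decide (k ≤ x.val), fun b x y hxy => ?_⟩
    have hval : ∀ z : ZMod m, ((z.val : ℕ) : ZMod m) = z := fun z => ZMod.natCast_zmod_val z
    have key : (((xor (decide (k ≤ x.val)) b).toNat + 2 * y.val : ℕ) : ZMod m) =
        (((xor (decide (k ≤ y.val)) b).toNat + 2 * x.val : ℕ) : ZMod m) := by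
      push_cast
      rw [hval, hval]
      linear_combination hxy
    rw [ZMod.natCast_eq_natCast_iff'] at key
    have hx := ZMod.val_lt x
    have hy := ZMod.val_lt y
    apply ZMod.val_injective m
    generalize x.val = X at *
    generalize y.val = Y at *
    have hpar : (xor (decide (k ≤ X)) b).toNat % 2 = (xor (decide (k ≤ Y)) b).toNat % 2 := by
      have := congrArg (· % 2) key
      simp only [hk, Nat.mod_mul_right_mod] at this
      omega
    have h2 : decide (k ≤ X) = decide (k ≤ Y) := by
      cases b <;> by_cases h1 : k ≤ X <;> by_cases h2 : k ≤ Y <;> simp_all <;> omega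
    rw [h2] at key
    have h3 : 2 * Y % (2 * k) = 2 * X % (2 * k) := by
      rw [hk] at key
      exact Nat.ModEq.add_left_cancel' _ key
    rw [Nat.mul_mod_mul_left, Nat.mul_mod_mul_left] at h3
    have h4 : Y % k = X % k := by omega
    by_cases h1 : k ≤ X
    · have h5 : k ≤ Y := by simpa [h1] using h2
      rw [Nat.mod_eq_sub_mod h1, Nat.mod_eq_sub_mod h5, Nat.mod_eq_of_lt (by omega),
        Nat.mod_eq_of_lt (by omega)] at h4
      omega
    · have h5 : ¬ k ≤ Y := by simpa [h1] using h2
      rw [Nat.mod_eq_of_lt (by omega), Nat.mod_eq_of_lt (by omega)] at h4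
      omega
  · refine ⟨fun _ => false, fun b x y hxy => ?_⟩
    have h2 : IsUnit (2 : ZMod m) := by
      have : IsUnit ((2 : ℕ) : ZMod m) := by
        rw [ZMod.isUnit_iff_coprime, hk]
        simp
      simpa using this
    have : (2 : ZMod m) * x = 2 * y := by
      have h := hxy
      simp only at h
      linear_combination -h
    exact h2.mul_left_cancel this

section EvenDesign

variable {m : ℕ} [NeZero m] {χ : ZMod m → Bool} {k : ℕ}

/-- The pairs `(x, y)` joined to the point `b` at infinity. -/
def Arc (χ : ZMod m → Bool) (k : ℕ) (b : Bool) (x y : ZMod m) : Prop :=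
  ∃ i < k, y = ((2 * i : ℕ) : ZMod m) + (((xor (χ x) b).toNat : ZMod m) - 2 * x)

/-- Triples with sum in `{0, …, 2k-1}` together with triples through two points at infinity. -/
def EvenRel (χ : ZMod m → Bool) (k : ℕ) :
    ZMod m ⊕ Bool → ZMod m ⊕ Bool → ZMod m ⊕ Bool → Prop
  | .inl x, .inl y, .inl z => x ≠ y ∧ x ≠ z ∧ y ≠ z ∧ ∃ s < 2 * k, x + y + z = (s : ℕ)
  | .inr b, .inl x, .inl y => x ≠ y ∧ (Arc χ k b x y ∨ Arc χ k b y x)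
  | .inl x, .inr b, .inl y => x ≠ y ∧ (Arc χ k b x y ∨ Arc χ k b y x)
  | .inl x, .inl y, .inr b => x ≠ y ∧ (Arc χ k b x y ∨ Arc χ k b y x)
  | _, _, _ => False

lemma isTripleRel_evenRel : IsTripleRel (EvenRel χ k) where
  swap_left := by
    rintro (x | a) (y | b) (z | c) h <;> simp only [EvenRel] at h ⊢
    · rw [add_comm y x]; exact ⟨h.1.symm, h.2.2.1, h.2.1, h.2.2.2⟩
    · exact ⟨h.1.symm, h.2.symm⟩
    · exact h
    · exact h
  swap_right := by
    rintro (x | a) (y | b) (z | c) h <;> simp only [EvenRel] at h ⊢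
    · rw [add_right_comm]; exact ⟨h.2.1, h.1, h.2.2.1.symm, h.2.2.2⟩
    · exact h
    · exact h
    · exact ⟨h.1.symm, h.2.symm⟩
  distinct := by
    rintro (x | a) (y | b) (z | c) h <;> simp only [EvenRel] at h <;> simp_all

lemma arc_iff {b : Bool} {x y : ZMod m} : Arc χ k b x y ↔
    ∃ s < 2 * k, 2 * x + y = (s : ℕ) ∧ b = xor (χ x) s.bodd := by
  constructor
  · rintro ⟨i, hi, rfl⟩
    refine ⟨2 * i + (xor (χ x) b).toNat, ?_, ?_, ?_⟩
    · have := Bool.toNat_lt (xor (χ x) b); omega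
    · push_cast; ring
    · cases χ x <;> cases b <;> simp
  · rintro ⟨s, hs, h, rfl⟩
    refine ⟨s.div2, ?_, ?_⟩
    · have := Nat.div2_val s; omega
    · have h1 : xor (χ x) (xor (χ x) s.bodd) = s.bodd := by
        cases χ x <;> cases s.bodd <;> rfl
      rw [h1, ← add_sub_assoc, ← Nat.cast_add, add_comm (2 * _), Nat.bodd_add_div2, ← h]; ring

/-- The third vertex of the triple with index `s` containing `x` and `y`. -/
def thirdVertex (χ : ZMod m → Bool) (x y : ZMod m) (s : ℕ) : ZMod m ⊕ Bool :=
  if 2 * x + y = (s : ZMod m) then .inr (xor (χ x) s.bodd)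
  else if 2 * y + x = (s : ZMod m) then .inr (xor (χ y) s.bodd)
  else .inl ((s : ZMod m) - x - y)

lemma evenRel_inl_inl {x y : ZMod m} (hxy : x ≠ y) {w : ZMod m ⊕ Bool} :
    EvenRel χ k (.inl x) (.inl y) w ↔ ∃ s < 2 * k, thirdVertex χ x y s = w := by
  rcases w with z | b
  · simp only [EvenRel, thirdVertex]
    constructor
    · rintro ⟨-, h1, h2, s, hs, h⟩
      refine ⟨s, hs, ?_⟩
      rw [if_neg, if_neg, ← h]
      · congr 1; ring
      · rw [← h]; intro h'; exact h2 (by linear_combination h')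
      · rw [← h]; intro h'; exact h1 (by linear_combination h')
    · rintro ⟨s, hs, h⟩
      split_ifs at h with h1 h2
      have hz : (s : ZMod m) - x - y = z := by simpa using h
      subst hz
      refine ⟨hxy, ?_, ?_, s, hs, by ring⟩
      · intro h3; exact h1 (by linear_combination h3)
      · intro h3; exact h2 (by linear_combination h3)
  · simp only [EvenRel, thirdVertex, arc_iff]
    constructor
    · rintro ⟨-, ⟨s, hs, h, rfl⟩ | ⟨s, hs, h, rfl⟩⟩
      · exact ⟨s, hs, by rw [if_pos h]⟩
      · refine ⟨s, hs, ?_⟩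
        rw [if_neg, if_pos h]
        rw [← h]; intro h'; exact hxy (by linear_combination h')
    · rintro ⟨s, hs, h⟩
      refine ⟨hxy, ?_⟩
      split_ifs at h with h1 h2
      · exact .inl ⟨s, hs, h1, by simpa using h.symm⟩
      · exact .inr ⟨s, hs, h2, by simpa using h.symm⟩

/-- The elements at which two triples through infinity can coincide. -/
def badPoints (m k : ℕ) [NeZero m] : Finset (ZMod m) :=
  univ.filter fun x => ∃ s < 2 * k, ∃ s' < 2 * k, 3 * x = 2 * (s : ZMod m) - (s' : ZMod m)

lemma natCast_inj_of_lt {s s' : ℕ} (hs : s < m) (hs' : s' < m)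
    (h : (s : ZMod m) = (s' : ZMod m)) : s = s' := by
  rwa [ZMod.natCast_eq_natCast_iff', Nat.mod_eq_of_lt hs, Nat.mod_eq_of_lt hs'] at h

lemma conbr_inl_inl {x y : ZMod m} (hxy : x ≠ y) :
    conbr (hyperOf (EvenRel χ k)) (.inl x) (.inl y) = (range (2 * k)).image (thirdVertex χ x y) := by
  ext w
  rw [isTripleRel_evenRel.mem_conbr, evenRel_inl_inl hxy]
  simp

lemma card_conbr_inl_inl (hk : 2 * k ≤ m) {x y : ZMod m} (hxy : x ≠ y)
    (h : x ∉ badPoints m k ∨ ∀ s < 2 * k, y ≠ (s : ZMod m) - 2 * x) :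
    2 * k ≤ (conbr (hyperOf (EvenRel χ k)) (.inl x) (.inl y)).card := by
  have hb : ∀ s < 2 * k, ∀ s' < 2 * k, 2 * x + y = (s : ℕ) → 2 * y + x = (s' : ℕ) → False := by
    intro s hs s' hs' h1 h2
    rcases h with h | h
    · refine h (Finset.mem_filter.2 ⟨mem_univ _, s, hs, s', hs', ?_⟩)
      rw [← h1, ← h2]; ring
    · exact h s hs (by rw [← h1]; ring)
  rw [conbr_inl_inl hxy, Finset.card_image_of_injOn, Finset.card_range]
  intro s hs s' hs' hss
  simp only [Finset.coe_range, Set.mem_Iio] at hs hs'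
  simp only [thirdVertex] at hss
  apply natCast_inj_of_lt (hs.trans_le hk) (hs'.trans_le hk)
  split_ifs at hss with h1 h2 h3 h4 h5 h6
  · rw [← h1, h2]
  · exact (hb s hs s' hs' h1 h3).elim
  · exact (hb s' hs' s hs h5 h4).elim
  · rw [← h4, h6]
  · have : (s : ZMod m) - x - y = (s' : ZMod m) - x - y := by simpa using hss
    linear_combination this

lemma exists_arc_inverse (hχ : ∀ b, Function.Injective fun x : ZMod m =>
    ((xor (χ x) b).toNat : ZMod m) - 2 * x) (b : Bool) : ∃ τ : ZMod m → ZMod m, ∀ x y,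
      ((xor (χ x) b).toNat : ZMod m) - 2 * x = y ↔ x = τ y := by
  have hbij := Finite.injective_iff_bijective.1 (hχ b)
  refine ⟨(Equiv.ofBijective _ hbij).symm, fun x y => ?_⟩
  rw [Equiv.eq_symm_apply]; rfl

lemma card_conbr_inr_inl_le (hχ : ∀ b, Function.Injective fun x : ZMod m =>
    ((xor (χ x) b).toNat : ZMod m) - 2 * x) (b : Bool) (x : ZMod m) :
    (conbr (hyperOf (EvenRel χ k)) (.inr b) (.inl x)).card ≤ 2 * k := by
  obtain ⟨τ, hτ⟩ := exists_arc_inverse hχ b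
  have : conbr (hyperOf (EvenRel χ k)) (.inr b) (.inl x) ⊆
      (range k).image (fun i => Sum.inl (((2 * i : ℕ) : ZMod m) +
        (((xor (χ x) b).toNat : ZMod m) - 2 * x))) ∪
      (range k).image (fun i => Sum.inl (τ (x - ((2 * i : ℕ) : ZMod m)))) := by
    rintro (y | c) hy <;> rw [isTripleRel_evenRel.mem_conbr] at hy <;> simp only [EvenRel] at hy
    rw [Finset.mem_union, Finset.mem_image, Finset.mem_image]
    rcases hy with ⟨-, ⟨i, hi, h⟩ | ⟨i, hi, h⟩⟩
    · exact .inl ⟨i, Finset.mem_range.2 hi, by rw [h]⟩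
    · refine .inr ⟨i, Finset.mem_range.2 hi, ?_⟩
      rw [(hτ y (x - ((2 * i : ℕ) : ZMod m))).1 (by rw [h]; ring)]
  refine (Finset.card_le_card this).trans ((Finset.card_union_le _ _).trans ?_)
  have h1 := Finset.card_image_le (s := range k) (f := fun i => (Sum.inl (((2 * i : ℕ) : ZMod m) +
        (((xor (χ x) b).toNat : ZMod m) - 2 * x)) : ZMod m ⊕ Bool))
  have h2 := Finset.card_image_le (s := range k)
    (f := fun i => (Sum.inl (τ (x - ((2 * i : ℕ) : ZMod m))) : ZMod m ⊕ Bool))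
  rw [Finset.card_range] at h1 h2
  omega

lemma le_card_conbr_inr_inl (hk : 2 * k ≤ m) (hχ : ∀ b, Function.Injective fun x : ZMod m =>
    ((xor (χ x) b).toNat : ZMod m) - 2 * x) (b : Bool) {x : ZMod m} (hx : x ∉ badPoints m k) :
    2 * k ≤ (conbr (hyperOf (EvenRel χ k)) (.inr b) (.inl x)).card := by
  have hb : ∀ y, Arc χ k b x y → Arc χ k b y x → False := by
    intro y h1 h2
    obtain ⟨s, hs, h1, -⟩ := arc_iff.1 h1
    obtain ⟨s', hs', h2, -⟩ := arc_iff.1 h2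
    refine hx (Finset.mem_filter.2 ⟨mem_univ _, s, hs, s', hs', ?_⟩)
    rw [← h1, ← h2]; ring
  have hne : ∀ y, Arc χ k b x y ∨ Arc χ k b y x → x ≠ y := by
    rintro y h rfl
    exact hb x (by tauto) (by tauto)
  have hinj : ∀ i < k, ∀ j < k, ((2 * i : ℕ) : ZMod m) = ((2 * j : ℕ) : ZMod m) → i = j := by
    intro i hi j hj h
    have := natCast_inj_of_lt (m := m) (by omega) (by omega) h
    omega
  obtain ⟨τ, hτ⟩ := exists_arc_inverse hχ b
  set f : ℕ → ZMod m ⊕ Bool := fun i => Sum.inl (((2 * i : ℕ) : ZMod m) +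
        (((xor (χ x) b).toNat : ZMod m) - 2 * x)) with hf
  set g : ℕ → ZMod m ⊕ Bool := fun i => Sum.inl (τ (x - ((2 * i : ℕ) : ZMod m))) with hg
  have hfa : ∀ i < k, Arc χ k b x (((2 * i : ℕ) : ZMod m) +
        (((xor (χ x) b).toNat : ZMod m) - 2 * x)) := fun i hi => ⟨i, hi, rfl⟩
  have hga : ∀ i < k, Arc χ k b (τ (x - ((2 * i : ℕ) : ZMod m))) x := by
    intro i hi
    refine ⟨i, hi, ?_⟩
    have := (hτ (τ (x - ((2 * i : ℕ) : ZMod m))) _).2 rfl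
    rw [this]; ring
  have hfc : ((range k).image f).card = k := by
    rw [Finset.card_image_of_injOn, Finset.card_range]
    intro i hi j hj hij
    simp only [Finset.coe_range, Set.mem_Iio] at hi hj
    refine hinj i hi j hj ?_
    have := Sum.inl.inj hij
    linear_combination this
  have hgc : ((range k).image g).card = k := by
    rw [Finset.card_image_of_injOn, Finset.card_range]
    intro i hi j hj hij
    simp only [Finset.coe_range, Set.mem_Iio] at hi hj
    refine hinj i hi j hj ?_
    have h1 := Sum.inl.inj hij
    have h2 := (hτ (τ (x - ((2 * i : ℕ) : ZMod m))) (x - ((2 * i : ℕ) : ZMod m))).2 rfl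
    have h3 := (hτ (τ (x - ((2 * i : ℕ) : ZMod m))) (x - ((2 * j : ℕ) : ZMod m))).2 h1
    linear_combination h2 - h3
  have hdisj : Disjoint ((range k).image f) ((range k).image g) := by
    rw [Finset.disjoint_left]
    intro w hw hw'
    obtain ⟨i, hi, rfl⟩ := Finset.mem_image.1 hw
    obtain ⟨j, hj, hij⟩ := Finset.mem_image.1 hw'
    have h1 := hga j (Finset.mem_range.1 hj)
    rw [Sum.inl.inj hij] at h1
    exact hb _ (hfa i (Finset.mem_range.1 hi)) h1
  have hsub : (range k).image f ∪ (range k).image g ⊆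
      conbr (hyperOf (EvenRel χ k)) (.inr b) (.inl x) := by
    intro w hw
    rw [isTripleRel_evenRel.mem_conbr]
    rcases Finset.mem_union.1 hw with hw | hw <;> obtain ⟨i, hi, rfl⟩ := Finset.mem_image.1 hw <;>
      rw [Finset.mem_range] at hi
    · exact ⟨hne _ (.inl (hfa i hi)), .inl (hfa i hi)⟩
    · exact ⟨hne _ (.inr (hga i hi)), .inr (hga i hi)⟩
  calc 2 * k = ((range k).image f ∪ (range k).image g).card := by
        rw [Finset.card_union_of_disjoint hdisj, hfc, hgc]; ring
    _ ≤ _ := Finset.card_le_card hsub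

lemma card_badPoints_le : (badPoints m k).card ≤ 12 * k ^ 2 := by
  have hsub : badPoints m k ⊆ ((range (2 * k) ×ˢ range (2 * k)) ×ˢ range 3).image
      fun p => ((((2 * (p.1.1 : ZMod m) - (p.1.2 : ZMod m)).val + p.2 * m) / 3 : ℕ) : ZMod m) := by
    intro x hx
    obtain ⟨-, s, hs, s', hs', h⟩ := Finset.mem_filter.1 hx
    have h1 : (3 * x.val) % m = (2 * (s : ZMod m) - (s' : ZMod m)).val := by
      rw [← h, ← ZMod.val_natCast]
      congr 1; push_cast; rw [ZMod.natCast_zmod_val]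
    have h2 := ZMod.val_lt x
    refine Finset.mem_image.2 ⟨((s, s'), 3 * x.val / m), ?_, ?_⟩
    · simp only [Finset.mem_product, Finset.mem_range]
      refine ⟨⟨hs, hs'⟩, ?_⟩
      rw [Nat.div_lt_iff_lt_mul (NeZero.pos m)]; omega
    · simp only
      rw [← h1, Nat.mod_add_div', Nat.mul_div_cancel_left _ (by norm_num), ZMod.natCast_zmod_val]
  refine (Finset.card_le_card hsub).trans (Finset.card_image_le.trans ?_)
  simp only [Finset.card_product, Finset.card_range]
  apply le_of_eq; ring

lemma card_conbr_le (hχ : ∀ b, Function.Injective fun x : ZMod m =>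
    ((xor (χ x) b).toNat : ZMod m) - 2 * x) {u v : ZMod m ⊕ Bool} (huv : u ≠ v) :
    (conbr (hyperOf (EvenRel χ k)) u v).card ≤ 2 * k := by
  rcases u with x | b <;> rcases v with y | c
  · rw [conbr_inl_inl (by simpa using huv)]
    exact Finset.card_image_le.trans (Finset.card_range _).le
  · rw [conbr_comm]; exact card_conbr_inr_inl_le hχ _ _
  · exact card_conbr_inr_inl_le hχ _ _
  · rw [Finset.card_eq_zero.2]
    · omega
    · rw [Finset.eq_empty_iff_forall_notMem]
      intro w hw
      rw [isTripleRel_evenRel.mem_conbr] at hw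
      rcases w with z | d <;> simp [EvenRel] at hw

/-- The even design has almost the maximum possible number of triples. -/
lemma card_hyperOf_evenRel (hk : 2 * k ≤ m) (hχ : ∀ b, Function.Injective fun x : ZMod m =>
    ((xor (χ x) b).toNat : ZMod m) - 2 * x) :
    2 * k * (m + 2) ^ 2 ≤ 6 * (hyperOf (EvenRel χ k)).card +
      2 * k * ((m + 2) + (4 + 12 * k ^ 2 * (2 * k + 4))) := by
  set B : Finset ((ZMod m ⊕ Bool) × (ZMod m ⊕ Bool)) :=
    univ.image (fun u => (u, u)) ∪ (univ.image (fun p : Bool × Bool => (.inr p.1, .inr p.2)) ∪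
      ((badPoints m k ×ˢ range (2 * k)).image
        (fun p => (Sum.inl p.1, Sum.inl ((p.2 : ZMod m) - 2 * p.1))) ∪
      ((badPoints m k ×ˢ (univ : Finset Bool)).image (fun p => (.inl p.1, .inr p.2)) ∪
      (badPoints m k ×ˢ (univ : Finset Bool)).image (fun p => (.inr p.2, .inl p.1))))) with hB
  have hBc : B.card ≤ (m + 2) + (4 + 12 * k ^ 2 * (2 * k + 4)) := by
    have h0 := card_badPoints_le (m := m) (k := k)
    have h1 : ((badPoints m k ×ˢ range (2 * k)).image (fun p : ZMod m × ℕ =>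
        ((Sum.inl p.1, Sum.inl ((p.2 : ZMod m) - 2 * p.1)) :
          (ZMod m ⊕ Bool) × (ZMod m ⊕ Bool)))).card ≤ (badPoints m k).card * (2 * k) :=
      Finset.card_image_le.trans (by simp)
    have h2 : ((badPoints m k ×ˢ (univ : Finset Bool)).image (fun p : ZMod m × Bool =>
        ((.inl p.1, .inr p.2) : (ZMod m ⊕ Bool) × (ZMod m ⊕ Bool)))).card ≤
          (badPoints m k).card * 2 := Finset.card_image_le.trans (by simp)
    have h3 : ((badPoints m k ×ˢ (univ : Finset Bool)).image (fun p : ZMod m × Bool =>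
        ((.inr p.2, .inl p.1) : (ZMod m ⊕ Bool) × (ZMod m ⊕ Bool)))).card ≤
          (badPoints m k).card * 2 := Finset.card_image_le.trans (by simp)
    have h4 : ((univ : Finset (ZMod m ⊕ Bool)).image (fun u => (u, u))).card ≤ m + 2 :=
      Finset.card_image_le.trans (by simp)
    have h5 : ((univ : Finset (Bool × Bool)).image (fun p : Bool × Bool =>
        ((.inr p.1, .inr p.2) : (ZMod m ⊕ Bool) × (ZMod m ⊕ Bool)))).card ≤ 4 :=
      Finset.card_image_le.trans (by simp)
    have h6 : (badPoints m k).card * (2 * k + 4) ≤ 12 * k ^ 2 * (2 * k + 4) :=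
      Nat.mul_le_mul_right _ h0
    rw [hB]
    refine (Finset.card_union_le _ _).trans (Nat.add_le_add h4 ?_)
    refine (Finset.card_union_le _ _).trans (Nat.add_le_add h5 ?_)
    refine le_trans ((Finset.card_union_le _ _).trans (Nat.add_le_add h1
      ((Finset.card_union_le _ _).trans (Nat.add_le_add h2 h3)))) ?_
    linarith
  have h := isTripleRel_evenRel.isUniformThree.mul_sq_le (H := hyperOf (EvenRel χ k)) (k := 2 * k) B ?_
  · have hc : Fintype.card (ZMod m ⊕ Bool) = m + 2 := by simp
    rw [hc] at h
    exact h.trans (Nat.add_le_add_left (Nat.mul_le_mul_left _ hBc) _)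
  · intro u v huv
    simp only [hB, Finset.mem_union, Finset.mem_image, Finset.mem_product, Finset.mem_univ,
      true_and, and_true, Finset.mem_range, Prod.exists, Prod.mk.injEq, not_or, not_exists,
      not_and] at huv
    obtain ⟨g1, g2, g3, g4, g5⟩ := huv
    rcases u with x | b <;> rcases v with y | c
    · refine card_conbr_inl_inl hk (fun h => g1 (.inl x) rfl (by rw [h])) ?_
      by_cases hx : x ∈ badPoints m k
      · right
        intro s hs h
        exact g3 x s ⟨hx, hs⟩ rfl (by rw [h])
      · exact .inl hx
    · rw [conbr_comm]
      exact le_card_conbr_inr_inl hk hχ _ fun hx => g4 x c hx rfl rfl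
    · exact le_card_conbr_inr_inl hk hχ _ fun hx => g5 y b hx rfl rfl
    · exact (g2 b c rfl rfl).elim

end EvenDesign

section SumDesign

variable {V : Type*} [Fintype V] [DecidableEq V] {N : ℕ}

/-- Distinct triples whose labels add up to `r`. -/
def SumRel (l : V ≃ ZMod N) (r : ZMod N) (u v w : V) : Prop :=
  (u ≠ v ∧ u ≠ w ∧ v ≠ w) ∧ l u + l v + l w = r

lemma isTripleRel_sumRel (l : V ≃ ZMod N) (r : ZMod N) : IsTripleRel (SumRel l r) where
  swap_left := fun x y z h =>
    ⟨⟨h.1.1.symm, h.1.2.2, h.1.2.1⟩, by rw [add_comm (l y)]; exact h.2⟩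
  swap_right := fun x y z h =>
    ⟨⟨h.1.2.1, h.1.1, h.1.2.2.symm⟩, by rw [add_right_comm]; exact h.2⟩
  distinct := fun x y z h => h.1

lemma card_conbr_sumRel_le (l : V ≃ ZMod N) (r : ZMod N) (u v : V) :
    (conbr (hyperOf (SumRel l r)) u v).card ≤ 1 := by
  rw [Finset.card_le_one]
  intro w hw w' hw'
  rw [(isTripleRel_sumRel l r).mem_conbr] at hw hw'
  apply l.injective
  linear_combination hw.2 - hw'.2

lemma sq_le_card_hyperOf_sumRel (l : V ≃ ZMod N) (r : ZMod N) :
    (Fintype.card V) ^ 2 ≤ 6 * (hyperOf (SumRel l r)).card + 3 * Fintype.card V := by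
  set B : Finset (V × V) := univ.image (fun u => (u, u)) ∪
    (univ.image (fun u => (u, l.symm (r - 2 * l u))) ∪
      univ.image (fun u => (l.symm (r - 2 * l u), u))) with hB
  have hBc : B.card ≤ 3 * Fintype.card V := by
    have hc : ∀ f : V → V × V, (univ.image f).card ≤ Fintype.card V :=
      fun f => Finset.card_image_le
    refine (Finset.card_union_le _ _).trans ?_
    refine (Nat.add_le_add (hc _) ((Finset.card_union_le _ _).trans
      (Nat.add_le_add (hc _) (hc _)))).trans ?_
    omega
  have h := (isTripleRel_sumRel l r).isUniformThree.mul_sq_le (k := 1) B ?_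
  · omega
  · intro u v huv
    simp only [hB, Finset.mem_union, Finset.mem_image, Finset.mem_univ, true_and, Prod.mk.injEq,
      not_or, not_exists, not_and] at huv
    obtain ⟨g1, g2, g3⟩ := huv
    rw [Nat.one_le_iff_ne_zero, ← Nat.pos_iff_ne_zero, Finset.card_pos]
    refine ⟨l.symm (r - l u - l v), ?_⟩
    rw [(isTripleRel_sumRel l r).mem_conbr]
    refine ⟨⟨g1 u rfl, ?_, ?_⟩, by rw [Equiv.apply_symm_apply]; ring⟩
    · intro h
      rw [Equiv.eq_symm_apply] at h
      refine g2 u rfl ?_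
      rw [Equiv.symm_apply_eq]; linear_combination -h
    · intro h
      rw [Equiv.eq_symm_apply] at h
      refine g3 v ?_ rfl
      rw [Equiv.symm_apply_eq]; linear_combination -h

end SumDesign

section OddDesign

variable {m : ℕ} [NeZero m]

/-- The label of a vertex of the even design. -/
def vertexLabel (m : ℕ) : ZMod m ⊕ Bool → ℕ
  | .inl x => x.val
  | .inr b => m + b.toNat

lemma exists_labelling (m : ℕ) [NeZero m] :
    ∃ l : ZMod m ⊕ Bool ≃ ZMod (m + 2), ∀ u, l u = (vertexLabel m u : ℕ) := by
  have hlt : ∀ u : ZMod m ⊕ Bool, vertexLabel m u < m + 2 := by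
    rintro (x | b)
    · exact (ZMod.val_lt x).trans (by omega)
    · have := Bool.toNat_lt b
      simp only [vertexLabel]; omega
  have hinj : Function.Injective fun u => ((vertexLabel m u : ℕ) : ZMod (m + 2)) := by
    intro u v h
    have h := natCast_inj_of_lt (hlt u) (hlt v) h
    rcases u with x | b <;> rcases v with y | c <;> simp only [vertexLabel] at h
    · rw [ZMod.val_injective m h]
    · have := ZMod.val_lt x; omega
    · have := ZMod.val_lt y; omega
    · congr 1
      cases b <;> cases c <;> simp_all
  refine ⟨Equiv.ofBijective _ ((Fintype.bijective_iff_injective_and_card _).2 ⟨hinj, ?_⟩),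
    fun u => rfl⟩
  simp

lemma card_inter_sumRel_le {χ : ZMod m → Bool} {k : ℕ} (hk : 2 * k + 5 < m)
    {l : ZMod m ⊕ Bool ≃ ZMod (m + 2)} (hl : ∀ u, l u = (vertexLabel m u : ℕ)) :
    (hyperOf (EvenRel χ k) ∩ hyperOf (SumRel l ((2 * k : ℕ) : ZMod (m + 2)))).card ≤ 36 * k := by
  set f : (ℕ × ℕ) × (ℕ × Bool) → Finset (ZMod m ⊕ Bool) := fun p =>
    {.inr p.2.2, .inl (((p.1.1 + p.1.2 * m + m + p.2.2.toNat - 2 * k - p.2.1 * (m + 2) : ℤ) : ZMod m)),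
      .inl ((p.1.1 : ZMod m) -
        2 * ((p.1.1 + p.1.2 * m + m + p.2.2.toNat - 2 * k - p.2.1 * (m + 2) : ℤ) : ZMod m))} with hf
  have hmod : ∀ {a b n : ℕ}, (a : ZMod n) = b → b < n → a = b + (a / n) * n := by
    intro a b n h hb
    rw [ZMod.natCast_eq_natCast_iff', Nat.mod_eq_of_lt hb] at h
    rw [← h, Nat.mod_add_div']
  have key : ∀ b x y, Arc χ k b x y →
      l (.inr b) + l (.inl x) + l (.inl y) = ((2 * k : ℕ) : ZMod (m + 2)) →
      ({.inr b, .inl x, .inl y} : Finset (ZMod m ⊕ Bool)) ∈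
        ((range (2 * k) ×ˢ range 3) ×ˢ (range 3 ×ˢ univ)).image f := by
    intro b x y h hs
    obtain ⟨s, hs', h, -⟩ := arc_iff.1 h
    simp only [hl, vertexLabel] at hs
    rw [← Nat.cast_add, ← Nat.cast_add] at hs
    have h' : ((2 * x.val + y.val : ℕ) : ZMod m) = (s : ℕ) := by
      push_cast; rw [ZMod.natCast_zmod_val, ZMod.natCast_zmod_val, h]
    have e1 := hmod h' (by omega)
    have e2 := hmod hs (by omega)
    have hx := ZMod.val_lt x
    have hy := ZMod.val_lt y
    have hb := Bool.toNat_lt b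
    have b1 : (2 * x.val + y.val) / m < 3 := by
      rw [Nat.div_lt_iff_lt_mul (by omega)]; omega
    have b2 : (m + b.toNat + x.val + y.val) / (m + 2) < 3 := by
      rw [Nat.div_lt_iff_lt_mul (by omega)]; omega
    have hxe : (x.val : ℤ) = s + ((2 * x.val + y.val) / m : ℕ) * m + m + b.toNat - 2 * k -
        ((m + b.toNat + x.val + y.val) / (m + 2) : ℕ) * (m + 2) := by
      zify at e1 e2
      push_cast at e1 e2 ⊢
      linear_combination e1 - e2
    have hxe' : x = ((s + ((2 * x.val + y.val) / m : ℕ) * m + m + b.toNat - 2 * k -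
        ((m + b.toNat + x.val + y.val) / (m + 2) : ℕ) * (m + 2) : ℤ) : ZMod m) := by
      rw [← hxe, Int.cast_natCast, ZMod.natCast_zmod_val]
    refine Finset.mem_image.2 ⟨((s, (2 * x.val + y.val) / m),
      ((m + b.toNat + x.val + y.val) / (m + 2), b)), ?_, ?_⟩
    · simp only [Finset.mem_product, Finset.mem_range, Finset.mem_univ, and_true]
      exact ⟨⟨hs', b1⟩, b2⟩
    · simp only [hf]
      rw [← hxe', ← h]
      congr 4; ring
  have key' : ∀ b x y, Arc χ k b x y ∨ Arc χ k b y x →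
      l (.inr b) + l (.inl x) + l (.inl y) = ((2 * k : ℕ) : ZMod (m + 2)) →
      ({.inr b, .inl x, .inl y} : Finset (ZMod m ⊕ Bool)) ∈
        ((range (2 * k) ×ˢ range 3) ×ˢ (range 3 ×ˢ univ)).image f := by
    rintro b x y (h | h) hs
    · exact key b x y h hs
    · rw [Finset.pair_comm]
      exact key b y x h (by rw [add_right_comm]; exact hs)
  have hsub : hyperOf (EvenRel χ k) ∩ hyperOf (SumRel l ((2 * k : ℕ) : ZMod (m + 2))) ⊆
      ((range (2 * k) ×ˢ range 3) ×ˢ (range 3 ×ˢ univ)).image f := by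
    intro e he
    obtain ⟨he1, he2⟩ := Finset.mem_inter.1 he
    obtain ⟨u, v, w, -, -, -, rfl⟩ :=
      Finset.card_eq_three.1 (isTripleRel_evenRel.isUniformThree e he1)
    rw [isTripleRel_evenRel.mem_hyperOf] at he1
    rw [(isTripleRel_sumRel _ _).mem_hyperOf] at he2
    have he2 := he2.2
    rcases u with x | a <;> rcases v with y | b <;> rcases w with z | c <;>
      simp only [EvenRel] at he1
    · exfalso
      obtain ⟨-, -, -, s, hs, h⟩ := he1
      simp only [hl, vertexLabel] at he2
      rw [← Nat.cast_add, ← Nat.cast_add] at he2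
      have h' : ((x.val + y.val + z.val : ℕ) : ZMod m) = (s : ℕ) := by
        push_cast; rw [ZMod.natCast_zmod_val, ZMod.natCast_zmod_val, ZMod.natCast_zmod_val, h]
      have e1 := hmod h' (by omega)
      have e2 := hmod he2 (by omega)
      have hx := ZMod.val_lt x
      have hy := ZMod.val_lt y
      have hz := ZMod.val_lt z
      have b1 : (x.val + y.val + z.val) / m < 3 := by
        rw [Nat.div_lt_iff_lt_mul (by omega)]; omega
      have b2 : (x.val + y.val + z.val) / (m + 2) < 3 := by
        rw [Nat.div_lt_iff_lt_mul (by omega)]; omega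
      generalize (x.val + y.val + z.val) / m = i at *
      generalize (x.val + y.val + z.val) / (m + 2) = j at *
      interval_cases i <;> interval_cases j <;> omega
    · rw [Finset.pair_comm, Finset.insert_comm]
      exact key' c x y he1.2 (by linear_combination he2)
    · rw [Finset.insert_comm]
      exact key' b x z he1.2 (by linear_combination he2)
    · exact key' a y z he1.2 he2
  refine (Finset.card_le_card hsub).trans (Finset.card_image_le.trans ?_)
  simp only [Finset.card_product, Finset.card_range, Finset.card_univ, Fintype.card_bool]
  omega

end OddDesign

/-- Near-optimal designs exist: the deficiency is at most `N / 3 + O(1)`. -/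
lemma exists_le_Dmax (t : ℕ) : ∃ K : ℕ, ∀ N : ℕ,
    (t - 1) * N ^ 2 ≤ 6 * Dmax N t + (t - 1) * N + 2 * N + K := by
  obtain ⟨k, hk⟩ := Nat.even_or_odd' (t - 1)
  set C := 2 * k * (4 + 12 * k ^ 2 * (2 * k + 4)) + 6 * (36 * k) with hC
  refine ⟨C + (t - 1) * (2 * k + 8) ^ 2, fun N => ?_⟩
  rcases lt_or_ge N (2 * k + 8) with hN | hN
  · have : (t - 1) * N ^ 2 ≤ (t - 1) * (2 * k + 8) ^ 2 :=
      Nat.mul_le_mul_left _ (Nat.pow_le_pow_left hN.le 2)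
    omega
  obtain ⟨m, rfl⟩ : ∃ m, N = m + 2 := ⟨N - 2, by omega⟩
  have : NeZero m := ⟨by omega⟩
  obtain ⟨χ, hχ⟩ := exists_coloring_injective m
  have hE := card_hyperOf_evenRel (k := k) (by omega) hχ
  have hcd := fun {u v} => card_conbr_le (k := k) hχ (u := u) (v := v)
  have hcV : Fintype.card (ZMod m ⊕ Bool) = m + 2 := by simp
  rcases hk with hk | hk
  · have h1 := (isTripleRel_evenRel (χ := χ) (k := k)).isUniformThree.card_le_Dmax (t := t)
      (fun u v huv => by rw [hk]; exact hcd huv)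
    rw [hcV] at h1
    rw [hk]
    nlinarith
  · obtain ⟨l, hl⟩ := exists_labelling m
    have hS := sq_le_card_hyperOf_sumRel l ((2 * k : ℕ) : ZMod (m + 2))
    have hI := card_inter_sumRel_le (χ := χ) (k := k) (by omega) hl
    have hU : IsUniformThree (hyperOf (EvenRel χ k) ∪
        hyperOf (SumRel l ((2 * k : ℕ) : ZMod (m + 2)))) := by
      intro e he
      rcases Finset.mem_union.1 he with he | he
      · exact isTripleRel_evenRel.isUniformThree e he
      · exact (isTripleRel_sumRel _ _).isUniformThree e he
    have h1 := hU.card_le_Dmax (t := t) (fun u v huv => by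
      rw [conbr_union, hk]
      exact (Finset.card_union_le _ _).trans
        (Nat.add_le_add (hcd huv) (card_conbr_sumRel_le _ _ _ _)))
    have h2 := Finset.card_union_add_card_inter (hyperOf (EvenRel χ k))
      (hyperOf (SumRel l ((2 * k : ℕ) : ZMod (m + 2))))
    rw [hcV] at h1 hS
    rw [hk]
    nlinarith

section TuranCount

lemma card_filter_range_mod (n : ℕ) {i : ℕ} (hi : i < 3) :
    ((range n).filter fun v => v % 3 = i).card = (n + 2 - i) / 3 := by
  induction n with
  | zero => simp; omega
  | succ n ih =>
    rw [Finset.range_add_one, Finset.filter_insert]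
    split_ifs with h
    · rw [Finset.card_insert_of_notMem (by simp), ih]; omega
    · rw [ih]; omega

lemma card_turanPart (n : ℕ) (i : Fin 3) : (turanPart n i).card = (n + 2 - i) / 3 := by
  rw [← card_filter_range_mod n i.2, ← Nat.Iio_eq_range, ← Fin.map_valEmbedding_univ,
    Finset.filter_map, Finset.card_map]
  rfl

lemma mem_turanPart {n : ℕ} {i : Fin 3} {v : Fin n} :
    v ∈ turanPart n i ↔ (v : ℕ) % 3 = i := by simp [turanPart]

lemma mem_T3 {n : ℕ} {e : Finset (Fin n)} : e ∈ T3 n ↔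
    ∃ x ∈ turanPart n 0, ∃ y ∈ turanPart n 1, ∃ z ∈ turanPart n 2, e = {x, y, z} := by
  simp only [T3, Finset.mem_filter, Finset.mem_univ, true_and]
  constructor
  · rintro ⟨-, h⟩
    obtain ⟨x, hx⟩ := Finset.card_eq_one.1 (h 0)
    obtain ⟨y, hy⟩ := Finset.card_eq_one.1 (h 1)
    obtain ⟨z, hz⟩ := Finset.card_eq_one.1 (h 2)
    have hx' : x ∈ e ∩ turanPart n 0 := by rw [hx]; simp
    have hy' : y ∈ e ∩ turanPart n 1 := by rw [hy]; simp
    have hz' : z ∈ e ∩ turanPart n 2 := by rw [hz]; simp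
    rw [Finset.mem_inter] at hx' hy' hz'
    refine ⟨x, hx'.2, y, hy'.2, z, hz'.2, ?_⟩
    ext v
    simp only [Finset.mem_insert, Finset.mem_singleton]
    constructor
    · intro hv
      have h3 : (v : ℕ) % 3 < 3 := Nat.mod_lt _ (by norm_num)
      have : (v : ℕ) % 3 = 0 ∨ (v : ℕ) % 3 = 1 ∨ (v : ℕ) % 3 = 2 := by omega
      rcases this with h0 | h0 | h0
      · left
        rw [← Finset.mem_singleton, ← hx]
        exact Finset.mem_inter.2 ⟨hv, mem_turanPart.2 h0⟩
      · right; left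
        rw [← Finset.mem_singleton, ← hy]
        exact Finset.mem_inter.2 ⟨hv, mem_turanPart.2 h0⟩
      · right; right
        rw [← Finset.mem_singleton, ← hz]
        exact Finset.mem_inter.2 ⟨hv, mem_turanPart.2 h0⟩
    · rintro (rfl | rfl | rfl)
      exacts [hx'.1, hy'.1, hz'.1]
  · rintro ⟨x, hx, y, hy, z, hz, rfl⟩
    rw [mem_turanPart] at hx hy hz
    simp only [Fin.val_zero, Fin.val_one, Fin.val_two] at hx hy hz
    refine ⟨Finset.card_eq_three.2 ⟨x, y, z, ?_, ?_, ?_, rfl⟩, fun i => ?_⟩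
    · rintro rfl; omega
    · rintro rfl; omega
    · rintro rfl; omega
    · rw [Finset.card_eq_one]
      fin_cases i
      · refine ⟨x, ?_⟩
        ext v
        simp only [Finset.mem_inter, Finset.mem_insert, Finset.mem_singleton, mem_turanPart]
        constructor
        · rintro ⟨rfl | rfl | rfl, h⟩ <;> simp_all
        · rintro rfl; simp [hx]
      · refine ⟨y, ?_⟩
        ext v
        simp only [Finset.mem_inter, Finset.mem_insert, Finset.mem_singleton, mem_turanPart]
        constructor
        · rintro ⟨rfl | rfl | rfl, h⟩ <;> simp_all
        · rintro rfl; simp [hy]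
      · refine ⟨z, ?_⟩
        ext v
        simp only [Finset.mem_inter, Finset.mem_insert, Finset.mem_singleton, mem_turanPart]
        constructor
        · rintro ⟨rfl | rfl | rfl, h⟩ <;> simp_all
        · rintro rfl; simp [hz]

lemma card_T3 (n : ℕ) : (T3 n).card = (n + 2) / 3 * ((n + 1) / 3) * (n / 3) := by
  have hc : (turanPart n 0 ×ˢ (turanPart n 1 ×ˢ turanPart n 2)).card =
      (n + 2) / 3 * ((n + 1) / 3) * (n / 3) := by
    rw [Finset.card_product, Finset.card_product, card_turanPart, card_turanPart, card_turanPart,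
      mul_assoc]
    rfl
  rw [← hc]
  symm
  refine Finset.card_bij (fun p _ => {p.1, p.2.1, p.2.2}) ?_ ?_ ?_
  · rintro ⟨x, y, z⟩ h
    simp only [Finset.mem_product] at h
    exact mem_T3.2 ⟨x, h.1, y, h.2.1, z, h.2.2, rfl⟩
  · rintro ⟨x, y, z⟩ h ⟨x', y', z'⟩ h' heq
    simp only [Finset.mem_product, mem_turanPart, Fin.val_zero, Fin.val_one, Fin.val_two] at h h'
    simp only at heq
    have hx : x ∈ ({x', y', z'} : Finset (Fin n)) := by rw [← heq]; simp
    have hy : y ∈ ({x', y', z'} : Finset (Fin n)) := by rw [← heq]; simp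
    have hz : z ∈ ({x', y', z'} : Finset (Fin n)) := by rw [← heq]; simp
    simp only [Finset.mem_insert, Finset.mem_singleton] at hx hy hz
    have e1 : x = x' := by
      rcases hx with rfl | rfl | rfl <;> omega
    have e2 : y = y' := by
      rcases hy with rfl | rfl | rfl <;> omega
    have e3 : z = z' := by
      rcases hz with rfl | rfl | rfl <;> omega
    rw [e1, e2, e3]
  · intro e he
    obtain ⟨x, hx, y, hy, z, hz, rfl⟩ := mem_T3.1 he
    exact ⟨(x, y, z), by simp [hx, hy, hz], rfl⟩

end TuranCount

/-- The size of a complete tripartite 3-graph with parts of sizes `a`, `b`, `c` together with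
an optimal design in each part. -/
noncomputable def tripartitePlus (t a b c : ℕ) : ℕ :=
  a * b * c + (Dmax a t + Dmax b t + Dmax c t)

lemma eT3plus_eq (n t : ℕ) :
    eT3plus n t = tripartitePlus t ((n + 2) / 3) ((n + 1) / 3) (n / 3) := by
  rw [eT3plus, tripartitePlus, card_T3, Fin.sum_univ_three, card_turanPart, card_turanPart,
    card_turanPart]
  rfl

lemma tripartitePlus_comm (t a b c : ℕ) : tripartitePlus t a b c = tripartitePlus t b a c := by
  unfold tripartitePlus; ring

lemma tripartitePlus_rotate (t a b c : ℕ) : tripartitePlus t a b c = tripartitePlus t b c a := by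
  unfold tripartitePlus; ring

lemma exists_tripartitePlus_le_move (t : ℕ) : ∃ L : ℕ, ∀ a b c : ℕ, b + 2 ≤ a →
    a + b + L ≤ 3 * c → tripartitePlus t a b c ≤ tripartitePlus t (a - 1) (b + 1) c := by
  obtain ⟨K, hK⟩ := exists_le_Dmax t
  refine ⟨t - 1 + K, fun a b c hab hc => ?_⟩
  obtain ⟨d, rfl⟩ : ∃ d, a = b + d + 2 := ⟨a - b - 2, by omega⟩
  have h1 := six_mul_Dmax_le (b + d + 2) t
  have h2 := six_mul_Dmax_le b t
  have h3 := hK (b + d + 2 - 1)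
  have h4 := hK (b + 1)
  unfold tripartitePlus
  have e1 : b + d + 2 - 1 = b + d + 1 := by omega
  rw [e1] at h1 h3 ⊢
  have h2' : 6 * Dmax b t + (t - 1) * b ≤ (t - 1) * b ^ 2 := by
    rcases b with _ | b
    · simpa using h2
    · rw [Nat.add_sub_cancel] at h2; nlinarith
  generalize t - 1 = l at *
  have h5 : (d + 1) * (2 * (b + d + 2 + b + (l + K))) ≤ (d + 1) * (2 * (3 * c)) := by gcongr
  nlinarith [Nat.zero_le (d * (b + d + b + K))]

/-- Balanced part sizes are optimal among nearly balanced ones. -/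
lemma exists_tripartitePlus_le (t : ℕ) : ∃ n1 : ℕ, ∀ n ≥ n1, ∀ a b c : ℕ, a + b + c = n →
    3 * n ≤ 10 * a → 3 * n ≤ 10 * b → 3 * n ≤ 10 * c →
    tripartitePlus t a b c ≤ eT3plus n t := by
  obtain ⟨L, hL⟩ := exists_tripartitePlus_le_move t
  refine ⟨5 * L, fun n hn => ?_⟩
  suffices h : ∀ M a b c : ℕ, a ^ 2 + b ^ 2 + c ^ 2 < M → a + b + c = n →
      3 * n ≤ 10 * a → 3 * n ≤ 10 * b → 3 * n ≤ 10 * c →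
      tripartitePlus t a b c ≤ eT3plus n t from
    fun a b c => h _ a b c (Nat.lt_succ_self _)
  intro M
  induction M with
  | zero => intro a b c h; omega
  | succ M ih =>
    intro a b c hM hn' ha hb hc
    have move : ∀ a b c : ℕ, a ^ 2 + b ^ 2 + c ^ 2 < M + 1 → a + b + c = n → 3 * n ≤ 10 * a →
        3 * n ≤ 10 * b → 3 * n ≤ 10 * c → b + 2 ≤ a → tripartitePlus t a b c ≤ eT3plus n t := by
      intro a b c hM hn' ha hb hc hab
      refine (hL a b c hab (by omega)).trans (ih _ _ _ ?_ (by omega) (by omega) (by omega) hc)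
      obtain ⟨d, rfl⟩ : ∃ d, a = b + d + 2 := ⟨a - b - 2, by omega⟩
      have e1 : b + d + 2 - 1 = b + d + 1 := by omega
      rw [e1]
      nlinarith
    by_cases h1 : b + 2 ≤ a
    · exact move a b c hM hn' ha hb hc h1
    by_cases h2 : a + 2 ≤ b
    · rw [tripartitePlus_comm]; exact move b a c (by omega) (by omega) hb ha hc h2
    by_cases h3 : c + 2 ≤ b
    · rw [tripartitePlus_rotate]; exact move b c a (by omega) (by omega) hb hc ha h3
    by_cases h4 : b + 2 ≤ c
    · rw [tripartitePlus_rotate, tripartitePlus_comm]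
      exact move c b a (by omega) (by omega) hc hb ha h4
    by_cases h5 : a + 2 ≤ c
    · rw [← tripartitePlus_rotate]; exact move c a b (by omega) (by omega) hc ha hb h5
    by_cases h6 : c + 2 ≤ a
    · rw [← tripartitePlus_rotate, tripartitePlus_comm]
      exact move a c b (by omega) (by omega) ha hc hb h6
    rw [eT3plus_eq]
    have key : ∀ x y z : ℕ, x ≤ y → y ≤ z → z ≤ x + 1 → x + y + z = n →
        z = (n + 2) / 3 ∧ y = (n + 1) / 3 ∧ x = n / 3 := by
      intro x y z h1 h2 h3 h4
      omega
    rcases le_total a b with hab | hab <;> rcases le_total b c with hbc | hbc <;>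
      rcases le_total a c with hac | hac
    · obtain ⟨e1, e2, e3⟩ := key a b c hab hbc (by omega) hn'
      rw [← e1, ← e2, ← e3, tripartitePlus_rotate, tripartitePlus_comm]
    · obtain ⟨e1, e2, e3⟩ := key a b c hab hbc (by omega) hn'
      rw [← e1, ← e2, ← e3, tripartitePlus_rotate, tripartitePlus_comm]
    · obtain ⟨e1, e2, e3⟩ := key a c b hac hbc (by omega) (by omega)
      rw [← e1, ← e2, ← e3, tripartitePlus_rotate]
    · obtain ⟨e1, e2, e3⟩ := key c a b hac hab (by omega) (by omega)
      rw [← e1, ← e2, ← e3, tripartitePlus_comm]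
    · obtain ⟨e1, e2, e3⟩ := key b a c hab hac (by omega) (by omega)
      rw [← e1, ← e2, ← e3, ← tripartitePlus_rotate]
    · obtain ⟨e1, e2, e3⟩ := key b c a hbc hac (by omega) (by omega)
      rw [← e1, ← e2, ← e3, ← tripartitePlus_rotate, tripartitePlus_comm]
    · obtain ⟨e1, e2, e3⟩ := key c b a hbc hab (by omega) (by omega)
      rw [← e1, ← e2, ← e3]
    · obtain ⟨e1, e2, e3⟩ := key c b a hbc hab (by omega) (by omega)
      rw [← e1, ← e2, ← e3]

section LowerBound

lemma T3_color_ne {n : ℕ} {u v w : Fin n} (h : ({u, v, w} : Finset (Fin n)) ∈ T3 n) :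
    (u : ℕ) % 3 ≠ (v : ℕ) % 3 ∧ (u : ℕ) % 3 ≠ (w : ℕ) % 3 ∧ (v : ℕ) % 3 ≠ (w : ℕ) % 3 := by
  have h3 : ({u, v, w} : Finset (Fin n)).card = 3 := (Finset.mem_filter.1 h).2.1
  obtain ⟨d1, d2, d3⟩ := IsUniformThree.distinct (H := {({u, v, w} : Finset (Fin n))})
    (fun e he => by rw [Finset.mem_singleton.1 he]; exact h3) (Finset.mem_singleton_self _)
  obtain ⟨x, hx, y, hy, z, hz, he⟩ := mem_T3.1 h
  simp only [mem_turanPart, Fin.val_zero, Fin.val_one, Fin.val_two] at hx hy hz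
  have hm : ∀ p ∈ ({u, v, w} : Finset (Fin n)), p = x ∨ p = y ∨ p = z := by
    intro p hp; rw [he] at hp; simpa using hp
  have hu := hm u (by simp)
  have hv := hm v (by simp)
  have hw := hm w (by simp)
  rcases hu with rfl | rfl | rfl <;> rcases hv with rfl | rfl | rfl <;>
    rcases hw with rfl | rfl | rfl <;> simp_all

lemma false_of_codegree {V : Type*} [Fintype V] [DecidableEq V] {G : Finset (Finset V)} {t : ℕ}
    (ht : 1 ≤ t) (hG : IsUniformThree G)
    (hd : ∀ u v : V, u ≠ v → (G.filter fun e => u ∈ e ∧ v ∈ e).card ≤ t - 1) {u v : V}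
    (g : Fin t → V) (hg : Function.Injective g) (h : ∀ j, ({u, v, g j} : Finset V) ∈ G) :
    False := by
  have huv := (hG.distinct (h ⟨0, ht⟩)).1
  have h1 := hd u v huv
  rw [hG.card_filter_pair huv] at h1
  have h2 : (univ.image g).card ≤ (conbr G u v).card := by
    refine Finset.card_le_card fun w hw => ?_
    obtain ⟨j, -, rfl⟩ := Finset.mem_image.1 hw
    exact mem_conbr.2 (h j)
  rw [Finset.card_image_of_injective _ hg, Finset.card_univ, Fintype.card_fin] at h2
  omega

/-- The construction `T_3(n,3)^{t+}` is `F_5(f_3;t)`-free. -/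
lemma eT3plus_le_exThree (n t : ℕ) (ht : 1 ≤ t) : eT3plus n t ≤ exThree n (F5b3 t) := by
  choose G h3 hs hd hc using fun i : Fin 3 => exists_card_eq_Dmax (turanPart n i) t
  have hT : IsUniformThree (T3 n) := fun e he => (Finset.mem_filter.1 he).2.1
  have hGT : ∀ i, Disjoint (T3 n) (G i) := by
    intro i
    rw [Finset.disjoint_left]
    intro e he he'
    obtain ⟨x, hx, y, hy, z, hz, rfl⟩ := mem_T3.1 he
    have hx' := hs i _ he' (by simp : x ∈ _)
    have hy' := hs i _ he' (by simp : y ∈ _)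
    rw [mem_turanPart] at hx hy hx' hy'
    simp at hx hy
    omega
  have hGG : ∀ i j, i ≠ j → Disjoint (G i) (G j) := by
    intro i j hij
    rw [Finset.disjoint_left]
    intro e he he'
    obtain ⟨x, hx⟩ : e.Nonempty := by rw [← Finset.card_pos, h3 i e he]; norm_num
    have h1 := mem_turanPart.1 (hs i e he hx)
    have h2 := mem_turanPart.1 (hs j e he' hx)
    exact hij (Fin.ext (h1.symm.trans h2))
  have hcard : (T3 n ∪ univ.biUnion G).card = eT3plus n t := by
    rw [Finset.card_union_of_disjoint, Finset.card_biUnion, eT3plus]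
    · simp_rw [hc]
    · intro i _ j _ hij; exact hGG i j hij
    · rw [Finset.disjoint_biUnion_right]; exact fun i _ => hGT i
  rw [← hcard]
  refine card_le_exThree ?_ ?_
  · intro e he
    rcases Finset.mem_union.1 he with he | he
    · exact hT e he
    · obtain ⟨i, -, he⟩ := Finset.mem_biUnion.1 he
      exact h3 i e he
  · rintro ⟨f, hf⟩
    have hedge : ∀ u v w : Fin n, ({u, v, w} : Finset (Fin n)) ∈ T3 n ∪ univ.biUnion G →
        ((u : ℕ) % 3 ≠ (v : ℕ) % 3 ∧ (u : ℕ) % 3 ≠ (w : ℕ) % 3 ∧ (v : ℕ) % 3 ≠ (w : ℕ) % 3) ∨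
        ∃ i, ({u, v, w} : Finset (Fin n)) ∈ G i ∧ (u : ℕ) % 3 = i ∧ (v : ℕ) % 3 = i ∧
          (w : ℕ) % 3 = i := by
      intro u v w h
      rcases Finset.mem_union.1 h with h | h
      · exact .inl (T3_color_ne h)
      · obtain ⟨i, -, h⟩ := Finset.mem_biUnion.1 h
        exact .inr ⟨i, h, mem_turanPart.1 (hs i _ h (by simp)),
          mem_turanPart.1 (hs i _ h (by simp)), mem_turanPart.1 (hs i _ h (by simp))⟩
    set a := f (.inl 0)
    set b := f (.inl 1)
    set c := f (.inl 2)
    set d := f (.inl 3)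
    have habc := hedge a b c (by
      have := hf _ (mem_F5b3.2 (.inl rfl)); simpa using this)
    have habx : ∀ j, _ := fun j => hedge a b (f (.inr j)) (by
      have := hf _ (mem_F5b3.2 (.inr (.inl ⟨j, rfl⟩))); simpa using this)
    have hcdx : ∀ j, _ := fun j => hedge c d (f (.inr j)) (by
      have := hf _ (mem_F5b3.2 (.inr (.inr ⟨j, rfl⟩)))
      rw [Finset.insert_comm, Finset.pair_comm] at this
      simpa using this)
    have hinj : Function.Injective fun j : Fin t => f (.inr j) := fun i j h => by
      simpa using f.injective h
    by_cases hab : (a : ℕ) % 3 = (b : ℕ) % 3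
    · have hi : (a : ℕ) % 3 < 3 := Nat.mod_lt _ (by norm_num)
      refine false_of_codegree ht (h3 ⟨_, hi⟩) (hd ⟨_, hi⟩) (u := a) (v := b) _ hinj fun j => ?_
      rcases habx j with h | ⟨i, h, h1, -⟩
      · exact (h.1 hab).elim
      · convert h
    · have hcol : ∀ j, (c : ℕ) % 3 = (f (.inr j) : ℕ) % 3 := by
        intro j
        rcases habc with h1 | ⟨i, -, h1⟩
        · rcases habx j with h2 | ⟨i, -, h2⟩ <;> omega
        · omega
      have hi : (c : ℕ) % 3 < 3 := Nat.mod_lt _ (by norm_num)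
      refine false_of_codegree ht (h3 ⟨_, hi⟩) (hd ⟨_, hi⟩) (u := c) (v := d) _ hinj fun j => ?_
      rcases hcdx j with h | ⟨i, h, h1, -⟩
      · exact (h.2.1 (hcol j)).elim
      · convert h

end LowerBound

/-- Growth of the construction when one vertex is added. -/
lemma eT3plus_add_sq_le (n t : ℕ) : eT3plus n t + (n / 3) ^ 2 ≤ eT3plus (n + 1) t := by
  rw [eT3plus_eq, eT3plus_eq]
  have e : ∀ m, tripartitePlus t ((m + 1 + 2) / 3) ((m + 1 + 1) / 3) ((m + 1) / 3) =
      tripartitePlus t (m / 3 + 1) ((m + 2) / 3) ((m + 1) / 3) := by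
    intro m; congr 1; omega
  rw [e, tripartitePlus_rotate t (n / 3 + 1), tripartitePlus, tripartitePlus]
  have h1 := Dmax_mono (Nat.le_succ (n / 3)) t
  have h2 : n / 3 ≤ (n + 1) / 3 := by omega
  have h3 : n / 3 ≤ (n + 2) / 3 := by omega
  have h4 : n / 3 * (n / 3) ≤ (n + 2) / 3 * ((n + 1) / 3) := Nat.mul_le_mul h3 h2
  rw [Nat.succ_eq_add_one] at h1
  nlinarith

/-- The numerical optimisation behind the approximate structure. -/
lemma density_estimate {α β e : ℝ} (he : 0 < e) (he' : e ≤ 1 / 100) (h1 : 2 / 9 - e ≤ α)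
    (hα : α ≤ 1) (hβ : 0 ≤ β) (hβα : β ≤ α) (h2 : 2 / 9 - e ≤ β * (1 - α))
    (h3 : α * (2 / 9 - e) ≤ e / 4 + 2 * α ^ 2 * (1 - α - β)) :
    1 / 27 - 5 * e ≤ α * (2 / 9 - e) - e / 4 - α ^ 2 * (1 - α - β) := by
  have hα5 : 1 / 5 ≤ α := by linarith
  have hα1 : α < 1 := by
    rcases hα.lt_or_eq with h | h
    · exact h
    · rw [h] at h2; linarith
  have a1 : 1 / 3 - 3 * e ≤ α := by
    by_contra h
    push Not at h
    have : β * (1 - α) ≤ α * (1 - α) := mul_le_mul_of_nonneg_right hβα (by linarith)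
    nlinarith
  have a2 : 1 / 9 - 1.125 * e ≤ α * (1 - α - β) := by
    by_contra h
    push Not at h
    have : α * (α * (1 - α - β)) < α * (1 / 9 - 1.125 * e) :=
      mul_lt_mul_of_pos_left h (by linarith)
    nlinarith
  have a3 : α ≤ 1 / 3 + 20 * e := by
    by_contra h
    push Not at h
    have e1 : (1 / 9 - 1.125 * e) * (1 - α) ≤ α * (1 - α - β) * (1 - α) :=
      mul_le_mul_of_nonneg_right a2 (by linarith)
    have e2 : α * (2 / 9 - e) ≤ α * (β * (1 - α)) := mul_le_mul_of_nonneg_left h2 (by linarith)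
    have e3 : 0 ≤ (α - 1 / 3) * (α ^ 2 - 5 / 3 * α + 1 / 3) + e * (α + 1.125) := by nlinarith
    have e4 : α ^ 2 - 5 / 3 * α + 1 / 3 ≤ -1 / 9 := by nlinarith
    have e5 : (α - 1 / 3) * (α ^ 2 - 5 / 3 * α + 1 / 3) ≤ (α - 1 / 3) * (-1 / 9) :=
      mul_le_mul_of_nonneg_left e4 (by linarith)
    nlinarith
  have a4 : 1 / 3 - 3 * e ≤ β := by
    by_contra h
    push Not at h
    have : β * (1 - α) ≤ (1 / 3 - 3 * e) * (1 - α) :=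
      mul_le_mul_of_nonneg_right h.le (by linarith)
    nlinarith
  have a5 : α * (1 - α - β) ≤ 1 / 9 + 10 * e := by
    have : α * (1 - α - β) ≤ (1 / 3 + 20 * e) * (1 / 3 + 6 * e) := by
      have h5 : α * (1 - α - β) ≤ α * (1 / 3 + 6 * e) :=
        mul_le_mul_of_nonneg_left (by linarith) (by linarith)
      exact h5.trans (mul_le_mul_of_nonneg_right a3 (by linarith))
    nlinarith
  have a6 : α * (α * (1 - α - β)) ≤ α * (1 / 9 + 10 * e) :=
    mul_le_mul_of_nonneg_left a5 (by linarith)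
  have a7 : (1 / 3 - 3 * e) * (1 / 9 - 11 * e) ≤ α * (1 / 9 - 11 * e) ∨ 1 / 9 - 11 * e < 0 := by
    rcases le_or_gt 0 (1 / 9 - 11 * e) with h | h
    · exact .inl (mul_le_mul_of_nonneg_right a1 h)
    · exact .inr h
  rcases a7 with a7 | a7
  · nlinarith
  · linarith

section ApproximateStructure

variable {V : Type*} [Fintype V] [DecidableEq V] {H : Finset (Finset V)} {t : ℕ}

lemma IsBlowFree.linkCount_conbr_le (hB : IsBlowFree t H) {a b c : V}
    (hc : c ∈ conbr H a b) :
    linkCount H c univ (conbr H a b) ≤ (t + 2) * Fintype.card V := by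
  have h : ∀ d ∈ (univ : Finset V), (conbr H c d ∩ conbr H a b).card ≤
      t + ((if d = a then Fintype.card V else 0) + if d = b then Fintype.card V else 0) := by
    intro d _
    by_cases hda : d = a
    · rw [if_pos hda]
      have := Finset.card_le_univ (conbr H c d ∩ conbr H a b)
      omega
    by_cases hdb : d = b
    · rw [if_pos hdb]
      have := Finset.card_le_univ (conbr H c d ∩ conbr H a b)
      omega
    have := hB a b c d (mem_conbr.1 hc) hda hdb
    rw [Finset.inter_comm] at this
    omega
  refine (Finset.sum_le_sum h).trans (le_of_eq ?_)
  rw [Finset.sum_add_distrib, Finset.sum_add_distrib, Finset.sum_ite_eq' univ a,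
    Finset.sum_ite_eq' univ b, Finset.sum_const, Finset.card_univ]
  simp
  ring

lemma linkCount_split (c : V) (S : Finset V) : linkCount H c univ univ ≤
    2 * linkCount H c univ S + linkCount H c Sᶜ Sᶜ := by
  have h1 := linkCount_union_right (H := H) c univ (disjoint_compl_right (a := S))
  have h2 := linkCount_union_left (H := H) c Sᶜ (disjoint_compl_right (a := S))
  have h3 : linkCount H c S Sᶜ ≤ linkCount H c univ S := by
    rw [linkCount_comm]; exact linkCount_mono c (Finset.subset_univ _) subset_rfl
  rw [Finset.union_compl] at h1 h2
  omega

/-- A dense 3-graph without `F_5(f_3;t)` is nearly tripartite. -/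
lemma IsBlowFree.exists_tripartition (hB : IsBlowFree t H) {e : ℝ}
    (he : 0 < e) (he' : e ≤ 1 / 100) (hn0 : 0 < Fintype.card V)
    (hn : 4 * (t + 2) ≤ e * Fintype.card V)
    (hdeg : ∀ v, (2 / 9 - e / 2) * (Fintype.card V : ℝ) ^ 2 ≤ linkCount H v univ univ) :
    ∃ S C B : Finset V, Disjoint S C ∧ Disjoint S B ∧ Disjoint C B ∧ S ∪ C ∪ B = univ ∧
      (1 / 27 - 5 * e) * (Fintype.card V : ℝ) ^ 3 ≤ tripleCount H S C B := by
  have hV : Nonempty V := Fintype.card_pos_iff.1 hn0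
  set N := Fintype.card V with hN
  have hNr : (0 : ℝ) < N := by exact_mod_cast hn0
  obtain ⟨⟨a, b⟩, -, hmax⟩ := Finset.exists_max_image (univ : Finset (V × V))
    (fun p => (conbr H p.1 p.2).card) Finset.univ_nonempty
  set S := conbr H a b with hS
  set s := S.card with hs
  have hcod : ∀ u v, (conbr H u v).card ≤ s := fun u v => hmax (u, v) (mem_univ _)
  have hsN : s ≤ N := Finset.card_le_univ _
  have hDpos : 0 < (2 / 9 - e) * (N : ℝ) ^ 2 := mul_pos (by linarith) (by positivity)
  have hT : 2 * (((t : ℝ) + 2) * N) ≤ e / 2 * (N : ℝ) ^ 2 := by nlinarith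
  have hsD : (2 / 9 - e) * (N : ℝ) ≤ s := by
    obtain ⟨v⟩ := hV
    have h1 := hdeg v
    have h2 : linkCount H v univ univ ≤ N * s :=
      linkCount_le_of_codegree _ _ _ fun x _ => by rw [Finset.inter_univ]; exact hcod _ _
    have h3 : (linkCount H v univ univ : ℝ) ≤ N * s := by exact_mod_cast h2
    have h4 : N * ((2 / 9 - e) * (N : ℝ)) ≤ N * s := by nlinarith
    exact le_of_mul_le_mul_left h4 hNr
  have hs0 : (0 : ℝ) < s := lt_of_lt_of_le (mul_pos (by linarith) hNr) hsD
  have hfar : ∀ u ∈ S, (2 / 9 - e) * (N : ℝ) ^ 2 ≤ linkCount H u Sᶜ Sᶜ := by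
    intro u hu
    have h1 := hdeg u
    have h2 := linkCount_split (H := H) u S
    have h3 : linkCount H u univ S ≤ (t + 2) * N := hB.linkCount_conbr_le hu
    have h4 : (linkCount H u univ univ : ℝ) ≤
        2 * (((t : ℝ) + 2) * N) + linkCount H u Sᶜ Sᶜ := by
      have : linkCount H u univ univ ≤ 2 * ((t + 2) * N) + linkCount H u Sᶜ Sᶜ := by omega
      exact_mod_cast this
    linarith
  obtain ⟨c, hc⟩ : S.Nonempty := by
    rw [← Finset.card_pos]; exact_mod_cast hs0
  have hScne : (Sᶜ).Nonempty := by
    by_contra h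
    rw [Finset.not_nonempty_iff_eq_empty] at h
    have := hfar c hc
    rw [h] at this
    simp [linkCount] at this
    linarith
  obtain ⟨y, hy, hymax⟩ := Finset.exists_max_image Sᶜ (fun y => (conbr H c y ∩ Sᶜ).card) hScne
  set B := conbr H c y ∩ Sᶜ with hBdef
  set C := Sᶜ \ B with hC
  have hBS : B ⊆ Sᶜ := Finset.inter_subset_right
  have hBs : B.card ≤ s := (Finset.card_le_card Finset.inter_subset_left).trans (hcod c y)
  have hScc : (Sᶜ).card = N - s := Finset.card_compl S
  have hCc : C.card = N - s - B.card := by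
    rw [hC, Finset.card_sdiff_of_subset hBS, hScc]
  have hBc' : B.card ≤ N - s := by rw [← hScc]; exact Finset.card_le_card hBS
  have hdisj : Disjoint C B := Finset.sdiff_disjoint
  have hCB : C ∪ B = Sᶜ := Finset.sdiff_union_of_subset hBS
  have hlinkc : (2 / 9 - e) * (N : ℝ) ^ 2 ≤ (N - s) * B.card := by
    refine (hfar c hc).trans ?_
    have : linkCount H c Sᶜ Sᶜ ≤ (N - s) * B.card := by
      rw [← hScc]
      exact linkCount_le_of_codegree _ _ _ hymax
    rw [← Nat.cast_sub hsN]
    exact_mod_cast this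
  have hBB : (tripleCount H S B B : ℝ) ≤ e / 4 * (N : ℝ) ^ 3 := by
    have h1 : tripleCount H S B B ≤ N * ((t + 2) * N) := by
      rw [tripleCount_rotate]
      refine (Finset.sum_le_card_nsmul B _ ((t + 2) * N) fun z hz => ?_).trans ?_
      · rw [linkCount_comm]
        exact (linkCount_mono z (Finset.subset_univ _) Finset.inter_subset_left).trans
          (hB.linkCount_conbr_le (Finset.mem_inter.1 hz).1)
      · rw [smul_eq_mul]
        exact Nat.mul_le_mul_right _ (Finset.card_le_univ _)
    have h2 : (tripleCount H S B B : ℝ) ≤ N * (((t : ℝ) + 2) * N) := by exact_mod_cast h1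
    nlinarith
  have hsum : ∀ u ∈ S, (2 / 9 - e) * (N : ℝ) ^ 2 ≤
      linkCount H u B B + linkCount H u C B + C.card * s := by
    intro u hu
    refine (hfar u hu).trans ?_
    have h1 : linkCount H u Sᶜ Sᶜ = linkCount H u C Sᶜ + linkCount H u B Sᶜ := by
      rw [← linkCount_union_left u Sᶜ hdisj, hCB]
    have h2 : linkCount H u B Sᶜ = linkCount H u B C + linkCount H u B B := by
      rw [← linkCount_union_right u B hdisj, hCB]
    have h3 : linkCount H u C Sᶜ ≤ C.card * s :=
      linkCount_le_of_codegree _ _ _ fun x _ =>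
        (Finset.card_le_card Finset.inter_subset_left).trans (hcod _ _)
    rw [linkCount_comm u B C] at h2
    have : linkCount H u Sᶜ Sᶜ ≤ linkCount H u B B + linkCount H u C B + C.card * s := by omega
    exact_mod_cast this
  have hQ : s * ((2 / 9 - e) * (N : ℝ) ^ 2) ≤
      tripleCount H S B B + tripleCount H S C B + s * (C.card * s) := by
    have h1 := Finset.card_nsmul_le_sum S _ _ hsum
    rw [Finset.sum_add_distrib, Finset.sum_add_distrib, Finset.sum_const, nsmul_eq_mul,
      nsmul_eq_mul] at h1
    unfold tripleCount
    push_cast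
    exact h1
  have hQle : (tripleCount H S C B : ℝ) ≤ s * (C.card * s) := by
    have : tripleCount H S C B ≤ s * (C.card * s) := by
      refine (Finset.sum_le_card_nsmul S _ (C.card * s) fun u _ => ?_).trans (le_of_eq rfl)
      exact linkCount_le_of_codegree _ _ _ fun x _ =>
        (Finset.card_le_card Finset.inter_subset_left).trans (hcod _ _)
    exact_mod_cast this
  refine ⟨S, C, B, ?_, ?_, hdisj, ?_, ?_⟩
  · exact disjoint_compl_right.mono_right (Finset.sdiff_subset)
  · exact disjoint_compl_right.mono_right hBS
  · rw [Finset.union_assoc, hCB, Finset.union_compl]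
  · have hCr : (C.card : ℝ) = N - s - B.card := by
      rw [hCc, Nat.cast_sub hBc', Nat.cast_sub hsN]
    obtain ⟨α, hα⟩ : ∃ α : ℝ, (s : ℝ) = α * N := ⟨s / N, by field_simp⟩
    obtain ⟨β, hβ⟩ : ∃ β : ℝ, (B.card : ℝ) = β * N := ⟨B.card / N, by field_simp⟩
    have hsNr : (s : ℝ) ≤ N := by exact_mod_cast hsN
    have hBsr : (B.card : ℝ) ≤ s := by exact_mod_cast hBs
    have hB0 : (0 : ℝ) ≤ B.card := Nat.cast_nonneg _
    rw [hCr] at hQ hQle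
    rw [hβ] at hQ hQle hlinkc hB0 hBsr
    rw [hα] at hQ hQle hlinkc hsD hsNr hBsr
    have hN3 : (0 : ℝ) < (N : ℝ) ^ 3 := by positivity
    have hN2 : (0 : ℝ) < (N : ℝ) ^ 2 := by positivity
    have key := density_estimate (α := α) (β := β) he he' (le_of_mul_le_mul_right hsD hNr)
      (by nlinarith) (by nlinarith) (le_of_mul_le_mul_right hBsr hNr)
      (le_of_mul_le_mul_right (by linarith) hN2)
      (le_of_mul_le_mul_right (by linarith) hN3)
    have := mul_le_mul_of_nonneg_right key hN3.le
    linarith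

end ApproximateStructure

section Coloring

variable {V : Type*} [Fintype V] [DecidableEq V] {H : Finset (Finset V)} {t : ℕ}

/-- The `i`-th class of a 3-coloring of the vertices. -/
def colorClass (f : V → Fin 3) (i : Fin 3) : Finset V := univ.filter fun v => f v = i

/-- The number of hyperedges meeting each colour class in one vertex. -/
def rainbowCount (H : Finset (Finset V)) (f : V → Fin 3) : ℕ :=
  tripleCount H (colorClass f 0) (colorClass f 1) (colorClass f 2)

lemma mem_colorClass {f : V → Fin 3} {i : Fin 3} {v : V} : v ∈ colorClass f i ↔ f v = i := by
  simp [colorClass]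

lemma disjoint_colorClass (f : V → Fin 3) {i j : Fin 3} (h : i ≠ j) :
    Disjoint (colorClass f i) (colorClass f j) := by
  rw [Finset.disjoint_left]
  intro v hv hw
  exact h ((mem_colorClass.1 hv).symm.trans (mem_colorClass.1 hw))

lemma sum_colorClass (f : V → Fin 3) (g : V → ℕ) :
    ∑ v, g v = ∑ i, ∑ v ∈ colorClass f i, g v :=
  (Finset.sum_fiberwise univ f g).symm

lemma sum_card_colorClass (f : V → Fin 3) :
    (colorClass f 0).card + (colorClass f 1).card + (colorClass f 2).card = Fintype.card V := by
  have := sum_colorClass f fun _ => 1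
  simp only [Fin.sum_univ_three, Finset.sum_const, smul_eq_mul, mul_one] at this
  rw [← this]; rfl

lemma tripleCount_swap (A B C : Finset V) : tripleCount H A B C = tripleCount H A C B :=
  Finset.sum_congr rfl fun _ _ => linkCount_comm _ _ _

lemma rainbowCount_eq (f : V → Fin 3) (i : Fin 3) : rainbowCount H f =
    tripleCount H (colorClass f i) (colorClass f (i + 1)) (colorClass f (i + 2)) := by
  fin_cases i
  · rfl
  · exact tripleCount_rotate _ _ _
  · exact (tripleCount_rotate _ _ _).trans (tripleCount_rotate _ _ _)

lemma rainbowCount_eq_of_ne (f : V → Fin 3) {i j k : Fin 3} (hij : i ≠ j) (hik : i ≠ k)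
    (hjk : j ≠ k) : rainbowCount H f =
    tripleCount H (colorClass f i) (colorClass f j) (colorClass f k) := by
  rw [rainbowCount_eq f i]
  have : (j = i + 1 ∧ k = i + 2) ∨ (k = i + 1 ∧ j = i + 2) := by revert i j k; decide
  obtain ⟨rfl, rfl⟩ | ⟨rfl, rfl⟩ := this
  · rfl
  · exact tripleCount_swap _ _ _

lemma sum_linkCount_colorClass (f : V → Fin 3) (B : Finset V) (c : V) :
    linkCount H c univ B = ∑ i, linkCount H c (colorClass f i) B :=
  sum_colorClass f _

lemma linkCount_univ_colorClass (f : V → Fin 3) (c : V) :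
    linkCount H c univ univ =
      ∑ i, ∑ j, linkCount H c (colorClass f i) (colorClass f j) := by
  rw [sum_linkCount_colorClass f]
  refine Finset.sum_congr rfl fun i _ => ?_
  rw [linkCount_comm, sum_linkCount_colorClass f]
  exact Finset.sum_congr rfl fun j _ => linkCount_comm _ _ _

lemma rainbowCount_eq_erase (f : V → Fin 3) (v : V) :
    rainbowCount H f =
      linkCount H v (colorClass f (f v + 1)) (colorClass f (f v + 2)) +
      tripleCount H ((colorClass f 0).erase v) ((colorClass f 1).erase v)
        ((colorClass f 2).erase v) := by
  have hrot : ∀ (Q : Fin 3 → Finset V) (i : Fin 3),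
      tripleCount H (Q 0) (Q 1) (Q 2) = tripleCount H (Q i) (Q (i + 1)) (Q (i + 2)) := by
    intro Q i
    fin_cases i
    · rfl
    · exact tripleCount_rotate _ _ _
    · exact (tripleCount_rotate _ _ _).trans (tripleCount_rotate _ _ _)
  rw [rainbowCount_eq f (f v), hrot (fun i => (colorClass f i).erase v) (f v)]
  have h1 : v ∉ colorClass f (f v + 1) := by
    rw [mem_colorClass]; generalize f v = i; revert i; decide
  have h2 : v ∉ colorClass f (f v + 2) := by
    rw [mem_colorClass]; generalize f v = i; revert i; decide
  simp only [Finset.erase_eq_of_notMem h1, Finset.erase_eq_of_notMem h2]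
  unfold tripleCount
  exact (Finset.add_sum_erase _ _ (mem_colorClass.2 rfl)).symm

lemma exists_optimal_coloring (H : Finset (Finset V)) :
    ∃ f : V → Fin 3, ∀ g, rainbowCount H g ≤ rainbowCount H f := by
  obtain ⟨f, -, hf⟩ := Finset.exists_max_image (univ : Finset (V → Fin 3)) (rainbowCount H)
    Finset.univ_nonempty
  exact ⟨f, fun g => hf g (mem_univ g)⟩

lemma IsUniformThree.linkCount_le_of_optimal (hH : IsUniformThree H) {f : V → Fin 3}
    (hf : ∀ g, rainbowCount H g ≤ rainbowCount H f) (v : V) (j : Fin 3) :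
    linkCount H v (colorClass f (j + 1)) (colorClass f (j + 2)) ≤
      linkCount H v (colorClass f (f v + 1)) (colorClass f (f v + 2)) := by
  have h := hf (Function.update f v j)
  have hQ : ∀ i, (colorClass (Function.update f v j) i).erase v = (colorClass f i).erase v := by
    intro i
    ext x
    simp only [Finset.mem_erase, mem_colorClass]
    refine and_congr_right fun hx => ?_
    rw [Function.update_of_ne hx]
  have hL : ∀ a b, linkCount H v (colorClass (Function.update f v j) a)
      (colorClass (Function.update f v j) b) = linkCount H v (colorClass f a) (colorClass f b) := by
    intro a b
    rw [← hH.linkCount_erase, hQ, hH.linkCount_erase, linkCount_comm, ← hH.linkCount_erase, hQ,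
      hH.linkCount_erase, linkCount_comm]
  rw [rainbowCount_eq_erase _ v, rainbowCount_eq_erase f v, hQ, hQ, hQ,
    Function.update_self, hL] at h
  omega

lemma triple_rotate (a b c : V) : ({a, b, c} : Finset V) = {c, a, b} := by
  ext x; simp only [Finset.mem_insert, Finset.mem_singleton]; tauto

lemma card_filter_notMem_add_linkCount (z : V) (A B : Finset V) :
    ((A ×ˢ B).filter fun p => ({z, p.1, p.2} : Finset V) ∉ H).card + linkCount H z A B =
      A.card * B.card := by
  have h : linkCount H z A B =
      ((A ×ˢ B).filter fun p => ({z, p.1, p.2} : Finset V) ∈ H).card := by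
    rw [Finset.card_filter, Finset.sum_product]
    unfold linkCount
    refine Finset.sum_congr rfl fun x _ => ?_
    rw [← Finset.card_filter]
    congr 1
    ext y
    rw [Finset.mem_inter, mem_conbr, Finset.mem_filter, and_comm]
  rw [h, ← Finset.card_product, add_comm]
  exact Finset.card_filter_add_card_filter_not _

/-- Vertices whose links are nearly complete between `A` and `B` span small codegrees. -/
lemma IsBlowFree.card_lt_of_dense (hB : IsBlowFree t H) {A B X : Finset V} {c v : V}
    (hX : X ⊆ conbr H c v) {θ : ℝ}
    (hz : ∀ z ∈ insert c X, (A.card : ℝ) * B.card ≤ linkCount H z A B + θ)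
    (hθ : (t + 1) * θ + A.card + B.card < (A.card : ℝ) * B.card) : X.card < t := by
  by_contra! hcard
  obtain ⟨Y, hYX, hYt⟩ := Finset.exists_subset_card_eq hcard
  set bad : V → Finset (V × V) := fun z =>
    (A ×ˢ B).filter fun p => ({z, p.1, p.2} : Finset V) ∉ H with hbad
  set E := (insert c Y).biUnion bad ∪ (({v} : Finset V) ×ˢ B ∪ A ×ˢ ({v} : Finset V)) with hE
  have hθ0 : 0 ≤ θ := by
    have h1 := hz c (Finset.mem_insert_self _ _)
    have h2 : (linkCount H c A B : ℝ) ≤ A.card * B.card := by exact_mod_cast linkCount_le_mul c A B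
    linarith
  have hbc : ∀ z ∈ insert c Y, ((bad z).card : ℝ) ≤ θ := by
    intro z hzz
    have h1 := hz z (Finset.insert_subset_insert _ hYX hzz)
    have h2 : ((bad z).card : ℝ) + linkCount H z A B = A.card * B.card := by
      exact_mod_cast card_filter_notMem_add_linkCount (H := H) z A B
    linarith
  have hEc : (E.card : ℝ) ≤ (t + 1) * θ + A.card + B.card := by
    have h1 : E.card ≤ ∑ z ∈ insert c Y, (bad z).card + (B.card + A.card) := by
      refine (Finset.card_union_le _ _).trans (Nat.add_le_add Finset.card_biUnion_le ?_)
      refine (Finset.card_union_le _ _).trans ?_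
      simp
    have h2 : (∑ z ∈ insert c Y, ((bad z).card : ℝ)) ≤ (insert c Y).card * θ := by
      rw [← nsmul_eq_mul]
      exact Finset.sum_le_card_nsmul _ _ _ hbc
    have h3 : ((insert c Y).card : ℝ) ≤ t + 1 := by
      have := Finset.card_insert_le c Y
      rw [hYt] at this
      exact_mod_cast this
    have h4 : (E.card : ℝ) ≤ ∑ z ∈ insert c Y, ((bad z).card : ℝ) + (B.card + A.card) := by
      exact_mod_cast h1
    nlinarith [mul_le_mul_of_nonneg_right h3 hθ0]
  have hlt : E.card < (A ×ˢ B).card := by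
    rw [Finset.card_product]
    exact_mod_cast hEc.trans_lt hθ
  obtain ⟨⟨a, b⟩, hab, habE⟩ := Finset.exists_mem_notMem_of_card_lt_card hlt
  obtain ⟨ha, hb⟩ := Finset.mem_product.1 hab
  simp only [hE, hbad, Finset.mem_union, Finset.mem_biUnion, Finset.mem_product,
    Finset.mem_singleton, Finset.mem_filter, not_or, not_exists, not_and, not_not] at habE
  obtain ⟨h1, h2, h3⟩ := habE
  have hm : ∀ z ∈ insert c Y, ({z, a, b} : Finset V) ∈ H := fun z hzz => h1 z hzz ⟨ha, hb⟩
  have hva : v ≠ a := fun h => h2 h.symm hb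
  have hvb : v ≠ b := fun h => h3 ha h.symm
  have hcm : ({a, b, c} : Finset V) ∈ H := by
    rw [triple_rotate]
    exact hm c (Finset.mem_insert_self _ _)
  have := hB a b c v hcm hva hvb
  have hsub : Y ⊆ conbr H a b ∩ conbr H c v := by
    intro z hzY
    refine Finset.mem_inter.2 ⟨?_, hX (hYX hzY)⟩
    rw [mem_conbr, triple_rotate]
    exact hm z (Finset.mem_insert_of_mem hzY)
  have := Finset.card_le_card hsub
  omega

lemma IsBlowFree.linkCount_mul_le (hB : IsBlowFree t H) {A B C : Finset V} {v d : V}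
    (hd : d ∉ A) :
    linkCount H v A C * ((conbr H v d ∩ B).card - t) + tripleCount H A C B ≤
      A.card * (C.card * B.card + (conbr H v d ∩ B).card) := by
  set x := (conbr H v d ∩ B).card with hx
  have hac : ∀ a ∈ A, ∀ c, (if c ∈ conbr H v a then x - t else 0) + (conbr H a c ∩ B).card ≤
      B.card + if c = d then x else 0 := by
    intro a ha c
    have h1 : (conbr H a c ∩ B).card ≤ B.card := Finset.card_le_card Finset.inter_subset_right
    split_ifs with hc hcd
    · omega
    · have hm : ({a, c, v} : Finset V) ∈ H := by
        rw [triple_rotate]; exact mem_conbr.1 hc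
      have h2 := hB a c v d hm (fun h => hd (h ▸ ha)) (fun h => hcd h.symm)
      have h3 := Finset.card_union_add_card_inter (conbr H a c ∩ B) (conbr H v d ∩ B)
      have h4 : ((conbr H a c ∩ B) ∪ (conbr H v d ∩ B)).card ≤ B.card :=
        Finset.card_le_card (Finset.union_subset Finset.inter_subset_right
          Finset.inter_subset_right)
      have h5 : ((conbr H a c ∩ B) ∩ (conbr H v d ∩ B)).card ≤
          (conbr H a c ∩ conbr H v d).card :=
        Finset.card_le_card (Finset.inter_subset_inter Finset.inter_subset_left
          Finset.inter_subset_left)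
      omega
    · omega
    · omega
  have ha : ∀ a ∈ A, (conbr H v a ∩ C).card * (x - t) + linkCount H a C B ≤
      C.card * B.card + x := by
    intro a ha
    have h1 := Finset.sum_le_sum fun c (_ : c ∈ C) => hac a ha c
    rw [Finset.sum_add_distrib, Finset.sum_add_distrib, Finset.sum_const, smul_eq_mul,
      Finset.sum_ite_eq', ← Finset.sum_filter, Finset.sum_const, smul_eq_mul,
      Finset.filter_mem_eq_inter, Finset.inter_comm] at h1
    refine h1.trans (Nat.add_le_add_left ?_ _)
    split_ifs <;> omega
  have h := Finset.sum_le_sum ha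
  rw [Finset.sum_add_distrib, ← Finset.sum_mul, Finset.sum_const, smul_eq_mul] at h
  exact h

end Coloring

section Structure

variable {V : Type*} [Fintype V] [DecidableEq V] {H : Finset (Finset V)} {t : ℕ}

lemma part_size_estimate {a b c N δ ω X : ℝ} (ha : 0 ≤ a) (hb : 0 ≤ b) (hc : 0 ≤ c)
    (hsum : a + b + c = N) (hN : 0 < N) (hω : 0 ≤ ω) (hδ : 12 * δ ≤ ω ^ 2)
    (hX : X ≤ a * b * c) (hX' : (1 / 27 - δ) * N ^ 3 ≤ X) :
    (1 / 3 - ω) * N ≤ a ∧ a ≤ (1 / 3 + ω) * N ∧ a * b * c ≤ 1 / 27 * N ^ 3 := by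
  have h1 : a * b * c ≤ a * ((N - a) / 2) ^ 2 := by
    have : b * c ≤ ((N - a) / 2) ^ 2 := by
      rw [← hsum]; nlinarith [sq_nonneg (b - c)]
    nlinarith
  have h2 : 1 / 27 * N ^ 3 - a * ((N - a) / 2) ^ 2 = (a - N / 3) ^ 2 * (4 / 3 * N - a) / 4 := by
    ring
  have h3 : (a - N / 3) ^ 2 * (N / 3) ≤ (a - N / 3) ^ 2 * (4 / 3 * N - a) :=
    mul_le_mul_of_nonneg_left (by linarith) (sq_nonneg _)
  have h4 : 0 ≤ (a - N / 3) ^ 2 * (N / 3) := by positivity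
  have h5 : (a - N / 3) ^ 2 ≤ (ω * N) ^ 2 := by
    have h6 : (a - N / 3) ^ 2 * N ≤ (12 * δ * N ^ 2) * N := by nlinarith
    have h7 := le_of_mul_le_mul_right h6 hN
    nlinarith [sq_nonneg N]
  have h8 := abs_le_of_sq_le_sq' h5 (by positivity)
  refine ⟨by linarith, by linarith, by linarith⟩

/-- Vertices of `S` whose links are nearly complete between `A` and `B` span few pairs in the
link of a vertex. -/
lemma IsBlowFree.exists_linkCount_self_le (hB : IsBlowFree t H) (S A B : Finset V) {θ : ℝ}
    (hθ : (t + 1) * θ + A.card + B.card < (A.card : ℝ) * B.card) :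
    ∃ m : ℕ, θ * m ≤ (S.card : ℝ) * A.card * B.card - tripleCount H S A B ∧
      ∀ v, linkCount H v S S ≤ S.card * (t + 2 * m) := by
  classical
  set R := S.filter fun z => (linkCount H z A B : ℝ) + θ < A.card * B.card with hR
  have hRS : R ⊆ S := Finset.filter_subset _ _
  refine ⟨R.card, ?_, fun v => ?_⟩
  · have h1 : ∀ z, (linkCount H z A B : ℝ) ≤ A.card * B.card := fun z => by
      exact_mod_cast linkCount_le_mul z A B
    have h2 : R.card • θ ≤ ∑ z ∈ R, ((A.card : ℝ) * B.card - linkCount H z A B) :=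
      Finset.card_nsmul_le_sum _ _ _ fun z hz => by
        have := (Finset.mem_filter.1 hz).2
        linarith
    have h3 : ∑ z ∈ R, ((A.card : ℝ) * B.card - linkCount H z A B) ≤
        ∑ z ∈ S, ((A.card : ℝ) * B.card - linkCount H z A B) :=
      Finset.sum_le_sum_of_subset_of_nonneg hRS fun z _ _ => sub_nonneg.2 (h1 z)
    have h3 := h2.trans h3
    rw [Finset.sum_sub_distrib, Finset.sum_const, nsmul_eq_mul, nsmul_eq_mul] at h3
    unfold tripleCount
    push_cast
    linarith
  · have h1 : linkCount H v S S = linkCount H v R S + linkCount H v (S \ R) S := by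
      rw [← linkCount_union_left v S Finset.disjoint_sdiff, Finset.union_sdiff_of_subset hRS]
    have h2 := linkCount_le_mul (H := H) v R S
    have h3 : linkCount H v (S \ R) S ≤ (S \ R).card * (t + R.card) := by
      refine linkCount_le_of_codegree _ _ _ fun x hx => ?_
      have h4 : (conbr H x v ∩ (S \ R)).card < t := by
        refine hB.card_lt_of_dense Finset.inter_subset_left (A := A) (B := B) (θ := θ) ?_ hθ
        intro z hz
        have hz' : z ∈ S \ R := by
          obtain rfl | hz := Finset.mem_insert.1 hz
          · exact hx
          · exact (Finset.mem_inter.1 hz).2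
        obtain ⟨hzS, hzR⟩ := Finset.mem_sdiff.1 hz'
        by_contra! hlt
        exact hzR (Finset.mem_filter.2 ⟨hzS, hlt⟩)
      have h5 : conbr H v x ∩ S ⊆ (conbr H x v ∩ (S \ R)) ∪ R := by
        intro y hy
        obtain ⟨hy1, hy2⟩ := Finset.mem_inter.1 hy
        by_cases hyR : y ∈ R
        · exact Finset.mem_union_right _ hyR
        · refine Finset.mem_union_left _ (Finset.mem_inter.2 ⟨?_, ?_⟩)
          · rwa [conbr_comm]
          · exact Finset.mem_sdiff.2 ⟨hy2, hyR⟩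
      have h6 := (Finset.card_le_card h5).trans (Finset.card_union_le _ _)
      omega
    have h7 : (S \ R).card * (t + R.card) ≤ S.card * (t + R.card) :=
      Nat.mul_le_mul_right _ (Finset.card_le_card Finset.sdiff_subset)
    nlinarith

/-- A vertex cannot have many link pairs both in `A × C` and in `C × B`. -/
lemma IsBlowFree.linkCount_lt_of_le (hB : IsBlowFree t H) {A B C : Finset V}
    (hAC : Disjoint A C) {v : V} {η δ : ℝ} (hη : 0 < η) (hη1 : η ≤ 1)
    (hN : t + 1 < (η ^ 2 - δ) * Fintype.card V)
    (hM : (A.card : ℝ) * C.card * B.card - tripleCount H A C B ≤ δ * (Fintype.card V : ℝ) ^ 3)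
    (hA : η * (Fintype.card V : ℝ) ^ 2 ≤ linkCount H v A C) :
    (linkCount H v C B : ℝ) < η * (Fintype.card V : ℝ) ^ 2 := by
  by_contra! hCB
  set N : ℝ := (Fintype.card V : ℝ) with hNdef
  have hcardN : ∀ S : Finset V, (S.card : ℝ) ≤ N := fun S => by
    rw [hNdef]; exact_mod_cast Finset.card_le_univ S
  have hV : Nonempty V := ⟨v⟩
  have hN0 : 0 < N := by rw [hNdef]; exact_mod_cast Fintype.card_pos
  obtain ⟨d, hdC, hd⟩ : ∃ d ∈ C, η * N ≤ (conbr H v d ∩ B).card := by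
    by_contra! hlt
    have hCne : C.Nonempty := by
      by_contra h
      rw [Finset.not_nonempty_iff_eq_empty] at h
      rw [h] at hCB
      simp only [linkCount, Finset.sum_empty, Nat.cast_zero] at hCB
      have : 0 < η * N ^ 2 := by positivity
      linarith
    have h1 : (linkCount H v C B : ℝ) < ∑ d ∈ C, η * N := by
      unfold linkCount
      push_cast
      exact Finset.sum_lt_sum_of_nonempty hCne hlt
    rw [Finset.sum_const, nsmul_eq_mul] at h1
    have h2 : (C.card : ℝ) * (η * N) ≤ N * (η * N) :=
      mul_le_mul_of_nonneg_right (hcardN C) (by positivity)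
    nlinarith
  have h1 := hB.linkCount_mul_le (H := H) (A := A) (B := B) (C := C) (v := v) (d := d)
    (Finset.disjoint_right.1 hAC hdC)
  set x := (conbr H v d ∩ B).card
  have hx : (x : ℝ) - t ≤ ((x - t : ℕ) : ℝ) := by
    rw [sub_le_iff_le_add]; exact_mod_cast (by omega : x ≤ x - t + t)
  have h2 : (linkCount H v A C : ℝ) * ((x - t : ℕ) : ℝ) + tripleCount H A C B ≤
      A.card * (C.card * B.card + x) := by exact_mod_cast h1
  have hxN : (x : ℝ) ≤ N := hcardN _
  have h3 : (linkCount H v A C : ℝ) * ((x - t : ℕ) : ℝ) ≤ δ * N ^ 3 + N * N := by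
    have : (A.card : ℝ) * x ≤ N * N := mul_le_mul (hcardN A) hxN (by positivity) hN0.le
    nlinarith
  have h4 : (η * N ^ 2) * (η * N - t) ≤ (linkCount H v A C : ℝ) * ((x - t : ℕ) : ℝ) := by
    refine (mul_le_mul_of_nonneg_left (b := η * N - t) (c := ((x - t : ℕ) : ℝ)) (by linarith)
      (by positivity)).trans ?_
    exact mul_le_mul_of_nonneg_right hA (by positivity)
  have h5 : N ^ 2 * ((η ^ 2 - δ) * N) ≤ N ^ 2 * (1 + η * t) := by nlinarith
  have h6 := le_of_mul_le_mul_left h5 (by positivity)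
  have h7 : η * t ≤ t := mul_le_of_le_one_left (by positivity) hη1
  linarith

/-- Few hyperedges lie inside a set of vertices whose links are nearly complete. -/
lemma IsUniformThree.tripleCount_self_le (hH : IsUniformThree H) (hB : IsBlowFree t H)
    (S A B : Finset V) {θ : ℝ}
    (hz : ∀ z ∈ S, (A.card : ℝ) * B.card ≤ linkCount H z A B + θ)
    (hθ : (t + 1) * θ + A.card + B.card < (A.card : ℝ) * B.card) :
    tripleCount H S S S ≤ 6 * Dmax S.card t := by
  set G := H.filter (· ⊆ S) with hG
  have hGH : IsUniformThree G := fun e he => hH e (Finset.mem_filter.1 he).1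
  have hsub : ∀ a ∈ S, ∀ b ∈ S, conbr G a b = conbr H a b ∩ S := by
    intro a ha b hb
    ext c
    rw [mem_conbr, Finset.mem_inter, mem_conbr, hG, Finset.mem_filter]
    refine and_congr_right fun _ => ?_
    simp [Finset.insert_subset_iff, ha, hb]
  have h1 : tripleCount H S S S ≤ 6 * G.card := by
    rw [← hGH.sum_linkCount]
    unfold tripleCount
    refine (Finset.sum_le_sum fun a ha => ?_).trans
      (Finset.sum_le_sum_of_subset (Finset.subset_univ S))
    unfold linkCount
    refine (Finset.sum_le_sum fun b hb => ?_).trans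
      (Finset.sum_le_sum_of_subset (Finset.subset_univ S))
    rw [Finset.inter_univ, hsub a ha b hb]
  have h2 : G.card ≤ Dmax S.card t := by
    refine _root_.card_le_Dmax hGH (fun e he => (Finset.mem_filter.1 he).2) fun u hu v hv huv => ?_
    rw [hGH.card_filter_pair huv, hsub u hu v hv]
    have : (conbr H u v ∩ S).card < t := by
      refine hB.card_lt_of_dense Finset.inter_subset_left (A := A) (B := B) (θ := θ) ?_ hθ
      intro z hzz
      obtain rfl | hzz := Finset.mem_insert.1 hzz
      · exact hz _ hu
      · exact hz _ (Finset.mem_inter.1 hzz).2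
    omega
  omega

end Structure

section Stability

variable {V : Type*} [Fintype V] [DecidableEq V] {H : Finset (Finset V)} {t : ℕ}

/-- Hyperedges with one vertex `w ∈ Q` and two vertices in `P` cost many missing crossing
hyperedges at `w`. -/
lemma IsBlowFree.linkCount_cross_le (hB : IsBlowFree t H) {P Q R : Finset V}
    (hPQ : Disjoint P Q) {w : V} {κ : ℝ} (hκ0 : 0 ≤ κ) (hκ : κ ≤ 1 / 1000)
    (hN : 1000 * ((t : ℝ) + 1) ≤ Fintype.card V)
    (hQ : 3 / 10 * (Fintype.card V : ℝ) ≤ Q.card) (hR : 3 / 10 * (Fintype.card V : ℝ) ≤ R.card)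
    (hP : ∀ u ∈ P, (Q.card : ℝ) * R.card ≤ linkCount H u Q R + κ * (Fintype.card V : ℝ) ^ 2)
    (hw : (P.card : ℝ) * R.card ≤ linkCount H w P R + κ * (Fintype.card V : ℝ) ^ 2) :
    (linkCount H w P P : ℝ) ≤ 25 * κ * (P.card * R.card - linkCount H w P R) := by
  set N : ℝ := (Fintype.card V : ℝ) with hNdef
  have ht0 : (0 : ℝ) ≤ t := by positivity
  have hN0 : 0 < N := by linarith
  have hcardN : ∀ S : Finset V, (S.card : ℝ) ≤ N := fun S => by
    rw [hNdef]; exact_mod_cast Finset.card_le_univ S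
  set U := P.filter fun u => (conbr H w u ∩ P).Nonempty with hU
  have hUP : U ⊆ P := Finset.filter_subset _ _
  have hY : ∀ u' ∈ U, ((conbr H w u' ∩ R).card : ℝ) ≤ N / 10 := by
    intro u' hu'
    obtain ⟨hu'P, u, hu⟩ := Finset.mem_filter.1 hu'
    obtain ⟨hu1, huP⟩ := Finset.mem_inter.1 hu
    have hm : ({u', w, u} : Finset V) ∈ H := by
      rw [← mem_conbr, conbr_comm]; exact hu1
    set Y := conbr H w u' ∩ R with hYdef
    have hYR : Y ⊆ R := Finset.inter_subset_right
    have h1 : linkCount H u Q Y ≤ Q.card * t + Y.card := by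
      have h2 : ∀ d ∈ Q, (conbr H u d ∩ Y).card ≤ t + if d = w then Y.card else 0 := by
        intro d hd
        split_ifs with hdw
        · exact (Finset.card_le_card Finset.inter_subset_right).trans (Nat.le_add_left _ _)
        · have h3 := hB u' w u d hm
            (fun h => Finset.disjoint_left.1 hPQ hu'P (h ▸ hd)) hdw
          have h4 : conbr H u d ∩ Y ⊆ conbr H u' w ∩ conbr H u d := by
            intro z hz
            obtain ⟨hz1, hz2⟩ := Finset.mem_inter.1 hz
            refine Finset.mem_inter.2 ⟨?_, hz1⟩
            rw [conbr_comm]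
            exact (Finset.mem_inter.1 hz2).1
          have := Finset.card_le_card h4
          omega
      refine (Finset.sum_le_sum h2).trans ?_
      rw [Finset.sum_add_distrib, Finset.sum_const, smul_eq_mul, Finset.sum_ite_eq']
      split_ifs <;> omega
    have h2 : linkCount H u Q R = linkCount H u Q Y + linkCount H u Q (R \ Y) := by
      rw [← linkCount_union_right u Q Finset.disjoint_sdiff, Finset.union_sdiff_of_subset hYR]
    have h3 := linkCount_le_mul (H := H) u Q (R \ Y)
    have h4 : ((R \ Y).card : ℝ) = R.card - Y.card := by
      rw [Finset.card_sdiff_of_subset hYR, Nat.cast_sub (Finset.card_le_card hYR)]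
    have h5 : (linkCount H u Q R : ℝ) ≤ Q.card * t + Y.card + Q.card * (R.card - Y.card) := by
      rw [← h4]
      have : linkCount H u Q R ≤ Q.card * t + Y.card + Q.card * (R \ Y).card := by omega
      exact_mod_cast this
    have h6 := hP u huP
    have h7 : (Q.card : ℝ) * t ≤ N * t := mul_le_mul_of_nonneg_right (hcardN Q) ht0
    have h8 : 3 / 10 * N * Y.card ≤ Q.card * Y.card :=
      mul_le_mul_of_nonneg_right hQ (by positivity)
    have h9 := hcardN Y
    have h10 : N * (3 / 10 * (Y.card : ℝ)) ≤ N * (t + 1 + κ * N) := by nlinarith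
    have h11 := le_of_mul_le_mul_left h10 hN0
    have h12 : κ * N ≤ 1 / 1000 * N := mul_le_mul_of_nonneg_right hκ hN0.le
    linarith
  have hmiss : (U.card : ℝ) * (N / 5) ≤ P.card * R.card - linkCount H w P R := by
    have h1 : ∀ u : V, ((conbr H w u ∩ R).card : ℝ) ≤ R.card := fun u => by
      exact_mod_cast Finset.card_le_card Finset.inter_subset_right
    have h2 : U.card • (N / 5) ≤ ∑ u ∈ U, ((R.card : ℝ) - (conbr H w u ∩ R).card) :=
      Finset.card_nsmul_le_sum _ _ _ fun u hu => by
        have := hY u hu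
        linarith
    have h3 : ∑ u ∈ U, ((R.card : ℝ) - (conbr H w u ∩ R).card) ≤
        ∑ u ∈ P, ((R.card : ℝ) - (conbr H w u ∩ R).card) :=
      Finset.sum_le_sum_of_subset_of_nonneg hUP fun u _ _ => sub_nonneg.2 (h1 u)
    have h4 := h2.trans h3
    rw [Finset.sum_sub_distrib, Finset.sum_const, nsmul_eq_mul, nsmul_eq_mul] at h4
    unfold linkCount
    push_cast
    linarith
  have hUc : (U.card : ℝ) ≤ 5 * κ * N := by
    have h1 : N * (U.card : ℝ) ≤ N * (5 * κ * N) := by nlinarith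
    exact le_of_mul_le_mul_left h1 hN0
  have hUU : linkCount H w P P ≤ U.card * U.card := by
    have h1 : ∀ u ∈ P, u ∉ U → (conbr H w u ∩ P).card = 0 := by
      intro u hu huU
      rw [Finset.card_eq_zero]
      by_contra h
      exact huU (Finset.mem_filter.2 ⟨hu, Finset.nonempty_iff_ne_empty.2 h⟩)
    unfold linkCount
    rw [← Finset.sum_subset hUP h1, ← smul_eq_mul]
    refine Finset.sum_le_card_nsmul _ _ _ fun u hu => Finset.card_le_card fun z hz => ?_
    obtain ⟨hz1, hz2⟩ := Finset.mem_inter.1 hz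
    refine Finset.mem_filter.2 ⟨hz2, u, Finset.mem_inter.2 ⟨mem_conbr_swap.1 hz1, hUP hu⟩⟩
  have h1 : (linkCount H w P P : ℝ) ≤ U.card * U.card := by exact_mod_cast hUU
  have h2 : (U.card : ℝ) * U.card ≤ U.card * (5 * κ * N) :=
    mul_le_mul_of_nonneg_left hUc (by positivity)
  nlinarith

lemma exists_rainbowCount_eq {S C B : Finset V} (hSC : Disjoint S C) (hSB : Disjoint S B)
    (hCB : Disjoint C B) (hU : S ∪ C ∪ B = univ) :
    ∃ f, rainbowCount H f = tripleCount H S C B := by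
  have hU' : ∀ v, v ∈ S ∨ v ∈ C ∨ v ∈ B := fun v => by
    have := Finset.mem_univ v
    rw [← hU] at this
    simpa [or_assoc] using this
  rw [Finset.disjoint_left] at hSC hSB hCB
  refine ⟨fun v => if v ∈ S then 0 else if v ∈ C then 1 else 2, ?_⟩
  unfold rainbowCount
  congr 1 <;> ext v <;> rw [mem_colorClass] <;>
    specialize @hSC v <;> specialize @hSB v <;> specialize @hCB v <;> specialize hU' v <;>
    split_ifs <;> simp_all

lemma linkCount_univ_eq_of_ne (f : V → Fin 3) (v : V) {i j k : Fin 3} (hij : i ≠ j)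
    (hik : i ≠ k) (hjk : j ≠ k) : linkCount H v univ univ =
      linkCount H v (colorClass f i) (colorClass f i) +
      linkCount H v (colorClass f j) (colorClass f j) +
      linkCount H v (colorClass f k) (colorClass f k) +
      2 * linkCount H v (colorClass f i) (colorClass f j) +
      2 * linkCount H v (colorClass f i) (colorClass f k) +
      2 * linkCount H v (colorClass f j) (colorClass f k) := by
  rw [linkCount_univ_colorClass f v]
  have h01 := linkCount_comm (H := H) v (colorClass f 0) (colorClass f 1)
  have h02 := linkCount_comm (H := H) v (colorClass f 0) (colorClass f 2)
  have h12 := linkCount_comm (H := H) v (colorClass f 1) (colorClass f 2)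
  simp only [Fin.sum_univ_three]
  have : (i = 0 ∧ j = 1 ∧ k = 2) ∨ (i = 0 ∧ j = 2 ∧ k = 1) ∨ (i = 1 ∧ j = 0 ∧ k = 2) ∨
      (i = 1 ∧ j = 2 ∧ k = 0) ∨ (i = 2 ∧ j = 0 ∧ k = 1) ∨ (i = 2 ∧ j = 1 ∧ k = 0) := by
    revert i j k; decide
  obtain ⟨rfl, rfl, rfl⟩ | ⟨rfl, rfl, rfl⟩ | ⟨rfl, rfl, rfl⟩ | ⟨rfl, rfl, rfl⟩ |
    ⟨rfl, rfl, rfl⟩ | ⟨rfl, rfl, rfl⟩ := this <;> omega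

lemma IsUniformThree.linkCount_le_of_optimal_of_ne (hH : IsUniformThree H) {f : V → Fin 3}
    (hf : ∀ g, rainbowCount H g ≤ rainbowCount H f) (v : V) {i j k : Fin 3} (hij : i ≠ j)
    (hik : i ≠ k) (hjk : j ≠ k) (hv : f v = i) :
    linkCount H v (colorClass f i) (colorClass f k) ≤
      linkCount H v (colorClass f j) (colorClass f k) := by
  have h := hH.linkCount_le_of_optimal hf v j
  rw [hv] at h
  have : (j = i + 1 ∧ k = i + 2) ∨ (k = i + 1 ∧ j = i + 2) := by
    clear h hv; revert i j k; decide
  obtain ⟨rfl, rfl⟩ | ⟨rfl, rfl⟩ := this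
  · have e1 : i + 1 + 1 = i + 2 := by clear h hv hij hik hjk; revert i; decide
    have e2 : i + 1 + 2 = i := by clear h hv hij hik hjk; revert i; decide
    rw [e1, e2, linkCount_comm] at h
    exact h
  · have e1 : i + 2 + 1 = i := by clear h hv hij hik hjk; revert i; decide
    have e2 : i + 2 + 2 = i + 1 := by clear h hv hij hik hjk; revert i; decide
    rw [e1, e2] at h
    exact h.trans_eq (linkCount_comm _ _ _)

/-- Counting hyperedges by the number of colour classes they meet. -/
lemma IsUniformThree.six_mul_card_eq (hH : IsUniformThree H) (f : V → Fin 3) : 6 * H.card =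
    6 * rainbowCount H f +
    ∑ i, tripleCount H (colorClass f i) (colorClass f i) (colorClass f i) +
    3 * ∑ i, (tripleCount H (colorClass f i) (colorClass f (i + 1)) (colorClass f (i + 1)) +
      tripleCount H (colorClass f i) (colorClass f (i + 2)) (colorClass f (i + 2))) := by
  set T : Fin 3 → Fin 3 → Fin 3 → ℕ :=
    fun i j k => tripleCount H (colorClass f i) (colorClass f j) (colorClass f k) with hT
  have hsum : 6 * H.card = ∑ i, ∑ j, ∑ k, T i j k := by
    rw [← hH.sum_linkCount, sum_colorClass f]
    refine Finset.sum_congr rfl fun i _ => ?_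
    simp only [hT, tripleCount]
    simp_rw [linkCount_univ_colorClass f]
    rw [Finset.sum_comm]
    refine Finset.sum_congr rfl fun j _ => ?_
    rw [Finset.sum_comm]
  have hrot : ∀ i j k, T i j k = T j k i := fun i j k => tripleCount_rotate _ _ _
  have hswap : ∀ i j k, T i j k = T i k j := fun i j k => tripleCount_swap _ _ _
  have hX : rainbowCount H f = T 0 1 2 := rfl
  rw [hsum, hX]
  change _ = _ + ∑ i, T i i i + 3 * ∑ i, (T i (i + 1) (i + 1) + T i (i + 2) (i + 2))
  simp only [Fin.sum_univ_three]
  have e : (0 + 1 : Fin 3) = 1 ∧ (0 + 2 : Fin 3) = 2 ∧ (1 + 1 : Fin 3) = 2 ∧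
    (1 + 2 : Fin 3) = 0 ∧ (2 + 1 : Fin 3) = 0 ∧ (2 + 2 : Fin 3) = 1 := by decide
  obtain ⟨e1, e2, e3, e4, e5, e6⟩ := e
  rw [e1, e2, e3, e4, e5, e6]
  have a1 := hrot 0 1 2
  have a2 := hrot 1 2 0
  have a3 := hswap 0 1 2
  have a4 := hswap 1 2 0
  have a5 := hswap 2 0 1
  have b1 := hrot 0 0 1
  have b2 := hrot 0 1 0
  have b3 := hrot 0 0 2
  have b4 := hrot 0 2 0
  have b5 := hrot 1 1 0
  have b6 := hrot 1 0 1
  have b7 := hrot 1 1 2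
  have b8 := hrot 1 2 1
  have b9 := hrot 2 2 0
  have b10 := hrot 2 0 2
  have b11 := hrot 2 2 1
  have b12 := hrot 2 1 2
  omega

end Stability

section NearExtremal

variable {V : Type*} [Fintype V] [DecidableEq V] {H : Finset (Finset V)} {t : ℕ}

/-- A 3-coloring whose classes have almost equal sizes and are almost completely joined. -/
structure IsNearlyComplete (H : Finset (Finset V)) (f : V → Fin 3) (κ M : ℝ) : Prop where
  le_card : ∀ i, (1 / 3 - κ / 5) * (Fintype.card V : ℝ) ≤ (colorClass f i).card
  card_le : ∀ i, ((colorClass f i).card : ℝ) ≤ (1 / 3 + κ / 5) * Fintype.card V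
  missing : ∀ i j k, i ≠ j → i ≠ k → j ≠ k →
    ((colorClass f i).card : ℝ) * (colorClass f j).card * (colorClass f k).card -
      tripleCount H (colorClass f i) (colorClass f j) (colorClass f k) = M
  missing_le : M ≤ κ ^ 2 / 1000 * (Fintype.card V : ℝ) ^ 3

lemma isNearlyComplete_of_le {f : V → Fin 3} {κ : ℝ} (hκ0 : 0 < κ)
    (hV : 0 < Fintype.card V)
    (hX : (1 / 27 - κ ^ 2 / 1000) * (Fintype.card V : ℝ) ^ 3 ≤ rainbowCount H f) :
    IsNearlyComplete H f κ (((colorClass f 0).card : ℝ) * (colorClass f 1).card *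
      (colorClass f 2).card - rainbowCount H f) := by
  have hN0 : (0 : ℝ) < Fintype.card V := by exact_mod_cast hV
  have hsum : ((colorClass f 0).card : ℝ) + (colorClass f 1).card + (colorClass f 2).card =
      Fintype.card V := by exact_mod_cast sum_card_colorClass f
  have hle : (rainbowCount H f : ℝ) ≤
      (colorClass f 0).card * (colorClass f 1).card * (colorClass f 2).card := by
    have : rainbowCount H f ≤
        (colorClass f 0).card * ((colorClass f 1).card * (colorClass f 2).card) := by
      rw [← smul_eq_mul]
      exact Finset.sum_le_card_nsmul _ _ _ fun a _ => linkCount_le_mul _ _ _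
    rw [mul_assoc]
    exact_mod_cast this
  have hδ : 12 * (κ ^ 2 / 1000) ≤ (κ / 5) ^ 2 := by nlinarith [sq_nonneg κ]
  have c0 : (0 : ℝ) ≤ (colorClass f 0).card := by positivity
  have c1 : (0 : ℝ) ≤ (colorClass f 1).card := by positivity
  have c2 : (0 : ℝ) ≤ (colorClass f 2).card := by positivity
  have s0 := part_size_estimate c0 c1 c2 hsum hN0 (by positivity) hδ hle hX
  have s1 := part_size_estimate c1 c2 c0 (by linarith) hN0 (by positivity) hδ
    (hle.trans_eq (by ring)) hX
  have s2 := part_size_estimate c2 c0 c1 (by linarith) hN0 (by positivity) hδ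
    (hle.trans_eq (by ring)) hX
  refine ⟨fun i => ?_, fun i => ?_, fun i j k hij hik hjk => ?_, ?_⟩
  · fin_cases i
    exacts [s0.1, s1.1, s2.1]
  · fin_cases i
    exacts [s0.2.1, s1.2.1, s2.2.1]
  · rw [← rainbowCount_eq_of_ne f hij hik hjk]
    have : (i = 0 ∧ j = 1 ∧ k = 2) ∨ (i = 0 ∧ j = 2 ∧ k = 1) ∨ (i = 1 ∧ j = 0 ∧ k = 2) ∨
        (i = 1 ∧ j = 2 ∧ k = 0) ∨ (i = 2 ∧ j = 0 ∧ k = 1) ∨ (i = 2 ∧ j = 1 ∧ k = 0) := by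
      revert i j k; decide
    obtain ⟨rfl, rfl, rfl⟩ | ⟨rfl, rfl, rfl⟩ | ⟨rfl, rfl, rfl⟩ | ⟨rfl, rfl, rfl⟩ |
      ⟨rfl, rfl, rfl⟩ | ⟨rfl, rfl, rfl⟩ := this <;> ring
  · have := s0.2.2
    nlinarith

variable {f : V → Fin 3} {κ M : ℝ}

lemma IsNearlyComplete.dense (hf : IsNearlyComplete H f κ M) (hκ : κ ≤ 1 / 1000)
    (hN : 1000 ≤ (Fintype.card V : ℝ)) {θ : ℝ} (hθ : (t + 1) * θ ≤ 1 / 20) (i j : Fin 3) :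
    (t + 1) * (θ * (Fintype.card V : ℝ) ^ 2) + (colorClass f i).card + (colorClass f j).card <
      ((colorClass f i).card : ℝ) * (colorClass f j).card := by
  have h1 := hf.le_card i
  have h2 := hf.le_card j
  set N := (Fintype.card V : ℝ)
  have h3 : 3 / 10 * N - 1 ≤ (colorClass f i).card - 1 := by nlinarith
  have h4 : 3 / 10 * N - 1 ≤ (colorClass f j).card - 1 := by nlinarith
  have h5 := mul_le_mul h3 h4 (by linarith) (by linarith)
  have h6 := mul_le_mul_of_nonneg_right hθ (sq_nonneg N)
  nlinarith

/-- In a nearly complete coloring with no cheap recoloring, few pairs of the link of a vertex lie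
inside a class. -/
lemma IsNearlyComplete.linkCount_self_le (hf : IsNearlyComplete H f κ M)
    (hB : IsBlowFree t H) (hκ : κ * (1000 * (t + 1)) = 1)
    (hN : 40000 * ((t : ℝ) + 1) ≤ κ ^ 2 * Fintype.card V) (hN' : 1000 ≤ (Fintype.card V : ℝ))
    (v : V) (i : Fin 3) :
    (linkCount H v (colorClass f i) (colorClass f i) : ℝ) ≤
      κ / 1000 * (Fintype.card V : ℝ) ^ 2 := by
  have ht0 : (0 : ℝ) ≤ t := by positivity
  have hκ0 : 0 < κ := by
    by_contra! h
    nlinarith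
  have hκ1 : κ ≤ 1 / 1000 := by nlinarith
  have hij : i ≠ i + 1 := by revert i; decide
  have hik : i ≠ i + 2 := by revert i; decide
  have hjk : i + 1 ≠ i + 2 := by revert i; decide
  obtain ⟨m, hm, hl⟩ := hB.exists_linkCount_self_le (colorClass f i) (colorClass f (i + 1))
    (colorClass f (i + 2)) (θ := 30 * κ * (Fintype.card V : ℝ) ^ 2)
    (hf.dense hκ1 hN' (by nlinarith) _ _)
  rw [hf.missing _ _ _ hij hik hjk] at hm
  have hm' := hm.trans hf.missing_le
  have hl' : (linkCount H v (colorClass f i) (colorClass f i) : ℝ) ≤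
      (colorClass f i).card * (t + 2 * m) := by exact_mod_cast hl v
  have hcard : ((colorClass f i).card : ℝ) ≤ Fintype.card V := by
    exact_mod_cast Finset.card_le_univ _
  set N := (Fintype.card V : ℝ)
  have hN0 : 0 < N := by linarith
  have h1 : (κ * N ^ 2) * (30 * m) ≤ (κ * N ^ 2) * (κ / 1000 * N) := by nlinarith
  have h2 := le_of_mul_le_mul_left h1 (by positivity)
  have h3 : (t : ℝ) ≤ κ / 10000 * N := by
    have : κ ^ 2 * N ≤ κ * N := by
      have := mul_pos hκ0 hN0
      nlinarith
    linarith
  have h4 : (t : ℝ) + 2 * m ≤ κ / 1000 * N := by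
    have := mul_pos hκ0 hN0
    linarith
  refine hl'.trans ?_
  calc ((colorClass f i).card : ℝ) * (t + 2 * m) ≤ N * (κ / 1000 * N) :=
        mul_le_mul hcard h4 (by positivity) hN0.le
    _ = κ / 1000 * N ^ 2 := by ring

/-- In an optimal coloring, the link of each vertex is nearly complete between the other two
classes. -/
lemma IsNearlyComplete.le_linkCount (hf : IsNearlyComplete H f κ M)
    (hH : IsUniformThree H) (hB : IsBlowFree t H)
    (hopt : ∀ g, rainbowCount H g ≤ rainbowCount H f) (hκ : κ * (1000 * (t + 1)) = 1)
    (hN : 40000 * ((t : ℝ) + 1) ≤ κ ^ 2 * Fintype.card V) (hN' : 1000 ≤ (Fintype.card V : ℝ))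
    (hdeg : ∀ v, (2 / 9 - κ ^ 2 / 10000) * (Fintype.card V : ℝ) ^ 2 ≤ linkCount H v univ univ)
    (v : V) {j k : Fin 3} (hj : f v ≠ j) (hk : f v ≠ k) (hjk : j ≠ k) :
    ((colorClass f j).card : ℝ) * (colorClass f k).card ≤
      linkCount H v (colorClass f j) (colorClass f k) + κ * (Fintype.card V : ℝ) ^ 2 := by
  have ht0 : (0 : ℝ) ≤ t := by positivity
  have hκ0 : 0 < κ := by
    by_contra! h
    nlinarith
  have hκ1 : κ ≤ 1 / 1000 := by nlinarith
  set i := f v with hi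
  have hsmall : ∀ a b : Fin 3, i ≠ a → i ≠ b → a ≠ b →
      (linkCount H v (colorClass f i) (colorClass f b) : ℝ) <
        κ / 10 * (Fintype.card V : ℝ) ^ 2 := by
    intro a b ha hb hab
    by_contra! hge
    have h1 := hB.linkCount_lt_of_le (A := colorClass f i) (B := colorClass f a)
      (C := colorClass f b) (disjoint_colorClass f hb) (δ := κ ^ 2 / 1000)
      (show (0 : ℝ) < κ / 10 by positivity) (by linarith) (by nlinarith)
      ((hf.missing i b a hb ha hab.symm).trans_le hf.missing_le) hge
    have h2 := hH.linkCount_le_of_optimal_of_ne hopt v ha hb hab hi.symm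
    rw [linkCount_comm v (colorClass f b)] at h1
    have h3 : (linkCount H v (colorClass f i) (colorClass f b) : ℝ) ≤
      linkCount H v (colorClass f a) (colorClass f b) := by exact_mod_cast h2
    linarith
  have h1 := hsmall j k hj hk hjk
  have h2 := hsmall k j hk hj hjk.symm
  have h3 := hf.linkCount_self_le hB hκ hN hN' v i
  have h4 := hf.linkCount_self_le hB hκ hN hN' v j
  have h5 := hf.linkCount_self_le hB hκ hN hN' v k
  have h6 := congrArg (Nat.cast (R := ℝ))
    (linkCount_univ_eq_of_ne (H := H) f v hj hk hjk)
  push_cast at h6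
  have h7 := hdeg v
  have h8 := mul_le_mul (hf.card_le j) (hf.card_le k) (by positivity) (by positivity)
  set N := (Fintype.card V : ℝ)
  have h9 : (1 / 3 + κ / 5) * N * ((1 / 3 + κ / 5) * N) ≤ (1 / 9 + κ / 5) * N ^ 2 := by
    have : 0 ≤ κ * (1 - κ) * N ^ 2 := by
      have : 0 ≤ 1 - κ := by linarith
      positivity
    nlinarith
  have h10 : κ ^ 2 * N ^ 2 ≤ κ * N ^ 2 := by
    refine mul_le_mul_of_nonneg_right ?_ (sq_nonneg N)
    nlinarith
  have h11 : 0 ≤ κ * N ^ 2 := by positivity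
  linarith

/-- A 3-graph without `F_5(f_3;t)` and with large minimum degree has at most as many hyperedges as
an almost balanced complete 3-partite 3-graph with optimal designs inside the parts. -/
lemma IsUniformThree.exists_card_le_tripartitePlus (hH : IsUniformThree H) (hB : IsBlowFree t H)
    (hκ : κ * (1000 * (t + 1)) = 1)
    (hN : 40000 * ((t : ℝ) + 1) ≤ κ ^ 2 * Fintype.card V)
    (hN' : 1000 * ((t : ℝ) + 1) ≤ Fintype.card V)
    (hdeg : ∀ v, (2 / 9 - κ ^ 2 / 10000) * (Fintype.card V : ℝ) ^ 2 ≤ linkCount H v univ univ) :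
    ∃ a b c, a + b + c = Fintype.card V ∧ 3 * Fintype.card V ≤ 10 * a ∧
      3 * Fintype.card V ≤ 10 * b ∧ 3 * Fintype.card V ≤ 10 * c ∧
      H.card ≤ tripartitePlus t a b c := by
  have ht0 : (0 : ℝ) ≤ t := by positivity
  have hκ0 : 0 < κ := by
    by_contra! h
    nlinarith
  have hκ1 : κ ≤ 1 / 1000 := by nlinarith
  have hN1 : (1000 : ℝ) ≤ Fintype.card V := by linarith
  have hV : 0 < Fintype.card V := by
    have : (0 : ℝ) < Fintype.card V := by linarith
    exact_mod_cast this
  obtain ⟨S, C, B, hSC, hSB, hCB, hU, hT⟩ := hB.exists_tripartition (e := κ ^ 2 / 5000)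
    (by positivity) (by nlinarith) hV (by linarith) fun v => by
      have := hdeg v
      have e : κ ^ 2 / 5000 / 2 = κ ^ 2 / 10000 := by ring
      rwa [e]
  obtain ⟨g, hg⟩ := exists_rainbowCount_eq (H := H) hSC hSB hCB hU
  obtain ⟨f, hopt⟩ := exists_optimal_coloring H
  have hX : (1 / 27 - κ ^ 2 / 1000) * (Fintype.card V : ℝ) ^ 3 ≤ rainbowCount H f := by
    have h1 : (rainbowCount H g : ℝ) ≤ rainbowCount H f := by exact_mod_cast hopt g
    rw [hg] at h1
    refine le_trans (le_of_eq ?_) (hT.trans h1)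
    ring
  have hf := isNearlyComplete_of_le hκ0 hV hX
  set M := ((colorClass f 0).card : ℝ) * (colorClass f 1).card *
      (colorClass f 2).card - rainbowCount H f with hMdef
  have hlink := fun v j k hj hk hjk =>
    hf.le_linkCount hH hB hopt hκ hN hN1 hdeg v (j := j) (k := k) hj hk hjk
  have hsize : ∀ i, 3 / 10 * (Fintype.card V : ℝ) ≤ (colorClass f i).card := by
    intro i
    have := hf.le_card i
    nlinarith
  have hinner : ∀ i, tripleCount H (colorClass f i) (colorClass f i) (colorClass f i) ≤
      6 * Dmax (colorClass f i).card t := by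
    intro i
    have hij : i ≠ i + 1 := by revert i; decide
    have hik : i ≠ i + 2 := by revert i; decide
    have hjk : i + 1 ≠ i + 2 := by revert i; decide
    refine hH.tripleCount_self_le hB _ (colorClass f (i + 1)) (colorClass f (i + 2))
      (θ := κ * (Fintype.card V : ℝ) ^ 2) (fun z hz => ?_)
      (hf.dense hκ1 hN1 (by nlinarith) _ _)
    rw [mem_colorClass] at hz
    exact hlink z _ _ (hz ▸ hij) (hz ▸ hik) hjk
  have hcross : ∀ i j k, i ≠ j → i ≠ k → j ≠ k →
      (tripleCount H (colorClass f j) (colorClass f i) (colorClass f i) : ℝ) ≤ 25 * κ * M := by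
    intro i j k hij hik hjk
    have h1 : ∀ w ∈ colorClass f j, (linkCount H w (colorClass f i) (colorClass f i) : ℝ) ≤
        25 * κ * ((colorClass f i).card * (colorClass f k).card -
          linkCount H w (colorClass f i) (colorClass f k)) := by
      intro w hw
      rw [mem_colorClass] at hw
      refine hB.linkCount_cross_le (disjoint_colorClass f hij) hκ0.le hκ1 hN' (hsize j) (hsize k)
        (fun u hu => ?_) ?_
      · rw [mem_colorClass] at hu
        exact hlink u _ _ (hu ▸ hij) (hu ▸ hik) hjk
      · exact hlink w _ _ (hw ▸ hij.symm) (hw ▸ hjk) hik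
    have h2 := Finset.sum_le_sum h1
    rw [← Finset.mul_sum, Finset.sum_sub_distrib, Finset.sum_const, nsmul_eq_mul] at h2
    rw [← hf.missing j i k hij.symm hjk hik]
    unfold tripleCount
    push_cast
    rw [mul_assoc ((colorClass f j).card : ℝ)]
    exact h2
  have hM0 : 0 ≤ M := by
    have h1 := hcross 0 1 2 (by decide) (by decide) (by decide)
    have h2 : 0 ≤ (25 * κ) * M := le_trans (by positivity) h1
    exact nonneg_of_mul_nonneg_right h2 (by positivity)
  refine ⟨(colorClass f 0).card, (colorClass f 1).card, (colorClass f 2).card,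
    sum_card_colorClass f, ?_, ?_, ?_, ?_⟩
  · have h : (3 * Fintype.card V : ℝ) ≤ 10 * (colorClass f 0).card := by linarith [hsize 0]
    exact_mod_cast h
  · have h : (3 * Fintype.card V : ℝ) ≤ 10 * (colorClass f 1).card := by linarith [hsize 1]
    exact_mod_cast h
  · have h : (3 * Fintype.card V : ℝ) ≤ 10 * (colorClass f 2).card := by linarith [hsize 2]
    exact_mod_cast h
  have h6 := congrArg (Nat.cast (R := ℝ)) (hH.six_mul_card_eq f)
  simp only [Fin.sum_univ_three] at h6
  push_cast at h6
  have hinner' : ∀ i, (tripleCount H (colorClass f i) (colorClass f i) (colorClass f i) : ℝ) ≤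
      6 * Dmax (colorClass f i).card t := fun i => by exact_mod_cast hinner i
  have i0 := hinner' 0
  have i1 := hinner' 1
  have i2 := hinner' 2
  have c01 := hcross 1 0 2 (by decide) (by decide) (by decide)
  have c02 := hcross 2 0 1 (by decide) (by decide) (by decide)
  have c10 := hcross 0 1 2 (by decide) (by decide) (by decide)
  have c12 := hcross 2 1 0 (by decide) (by decide) (by decide)
  have c20 := hcross 0 2 1 (by decide) (by decide) (by decide)
  have c21 := hcross 1 2 0 (by decide) (by decide) (by decide)
  have hκM : κ * M ≤ 1 / 1000 * M := mul_le_mul_of_nonneg_right hκ1 hM0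
  have hfin : (H.card : ℝ) ≤ ((tripartitePlus t (colorClass f 0).card (colorClass f 1).card
      (colorClass f 2).card : ℕ) : ℝ) := by
    unfold tripartitePlus
    push_cast
    linarith
  exact_mod_cast hfin

end NearExtremal

section ProgressiveInduction

/-- Deleting a vertex lying in few hyperedges. -/
lemma exThree_succ_le {W : Type*} [DecidableEq W] {n : ℕ} {F : Finset (Finset W)}
    {H : Finset (Finset (Fin (n + 1)))} (h3 : ∀ e ∈ H, e.card = 3) (hc : ¬ HasCopy H F)
    (v : Fin (n + 1)) : H.card ≤ exThree n F + (H.filter (v ∈ ·)).card := by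
  set g : Fin n ↪ Fin (n + 1) := v.succAboveEmb with hg
  set G : Finset (Finset (Fin n)) := univ.filter fun e => e.map g ∈ H with hG
  have hG3 : ∀ e ∈ G, e.card = 3 := by
    intro e he
    rw [← Finset.card_map g]
    exact h3 _ (Finset.mem_filter.1 he).2
  have hGc : ¬ HasCopy G F := by
    rintro ⟨φ, hφ⟩
    refine hc ⟨φ.trans g, fun e he => ?_⟩
    have := (Finset.mem_filter.1 (hφ e he)).2
    rw [Finset.map_eq_image, Finset.image_image] at this
    exact this
  have h1 := card_le_exThree hG3 hGc
  have h2 : (H.filter (v ∉ ·)).card ≤ G.card := by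
    rw [← Finset.card_map (Finset.mapEmbedding g).toEmbedding]
    refine Finset.card_le_card fun e he => ?_
    obtain ⟨heH, hv⟩ := Finset.mem_filter.1 he
    have hrange : ∃ e' : Finset (Fin n), e'.map g = e := by
      refine ⟨univ.filter fun x => g x ∈ e, ?_⟩
      ext x
      simp only [Finset.mem_map, Finset.mem_filter, Finset.mem_univ, true_and]
      constructor
      · rintro ⟨y, hy, rfl⟩
        exact hy
      · intro hx
        obtain ⟨y, rfl⟩ := Fin.exists_succAbove_eq (x := x) (y := v) fun h => hv (h ▸ hx)
        exact ⟨y, hx, rfl⟩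
    obtain ⟨e', rfl⟩ := hrange
    exact Finset.mem_map.2 ⟨e', Finset.mem_filter.2 ⟨Finset.mem_univ _, heH⟩, rfl⟩
  have h4 := Finset.card_filter_add_card_filter_not (s := H) (v ∈ ·)
  omega

/-- Progressive induction: a nonnegative excess that drops whenever it does not vanish is
eventually zero. -/
lemma eventually_eq_zero_of_drop {φ : ℕ → ℕ} {m : ℕ}
    (h : ∀ n ≥ m, φ (n + 1) = 0 ∨ φ (n + 1) + 1 ≤ φ n) : ∃ k, ∀ n ≥ k, φ n = 0 := by
  have key : ∀ n ≥ m, φ n + n ≤ φ m + m ∨ φ n = 0 := by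
    intro n hn
    induction n, hn using Nat.le_induction with
    | base => exact Or.inl le_rfl
    | succ n hn ih =>
      obtain h0 | h1 := h n hn
      · exact Or.inr h0
      · omega
  refine ⟨φ m + m + 1, fun n hn => ?_⟩
  have := key n (by omega)
  omega

/-- For large `n`, an extremal 3-graph on `n + 1` vertices is either no larger than the
construction or has a vertex whose deletion increases the excess. -/
lemma exists_exThree_drop (t : ℕ) (ht : 1 ≤ t) : ∃ m : ℕ, ∀ n ≥ m,
    exThree (n + 1) (F5b3 t) ≤ eT3plus (n + 1) t ∨
      exThree (n + 1) (F5b3 t) + 1 ≤ exThree n (F5b3 t) + (n / 3) ^ 2 := by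
  obtain ⟨n1, hn1⟩ := exists_tripartitePlus_le t
  set κ : ℝ := 1 / (1000 * (t + 1)) with hκdef
  have ht0 : (0 : ℝ) ≤ t := by positivity
  have hκ0 : 0 < κ := by positivity
  have hκ : κ * (1000 * (t + 1)) = 1 := by
    rw [hκdef]; field_simp
  obtain ⟨n2, hn2⟩ := exists_nat_ge (40000 * ((t : ℝ) + 1) / κ ^ 2)
  refine ⟨n1 + n2, fun n hn => ?_⟩
  have hN : 40000 * ((t : ℝ) + 1) ≤ κ ^ 2 * ((n + 1 : ℕ) : ℝ) := by
    rw [div_le_iff₀ (by positivity)] at hn2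
    have h1 : (n2 : ℝ) ≤ ((n + 1 : ℕ) : ℝ) := by exact_mod_cast (by omega : n2 ≤ n + 1)
    have h2 := mul_le_mul_of_nonneg_right h1 (sq_nonneg κ)
    linarith
  have hκ1 : κ ^ 2 ≤ 1 / 1000 := by nlinarith
  have hN' : 1000 * ((t : ℝ) + 1) ≤ ((n + 1 : ℕ) : ℝ) := by
    have := mul_le_mul_of_nonneg_right hκ1 (Nat.cast_nonneg (α := ℝ) (n + 1))
    linarith
  obtain ⟨H, h3, hc, hcard⟩ := exists_card_eq_exThree (n + 1) (F := F5b3 t)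
    ⟨{Sum.inl 0, Sum.inl 1, Sum.inl 2}, by simp [F5b3]⟩
  have hH : IsUniformThree H := h3
  by_cases hdeg : ∀ v, (2 / 9 - κ ^ 2 / 10000) * ((n + 1 : ℕ) : ℝ) ^ 2 ≤ linkCount H v univ univ
  · left
    obtain ⟨a, b, c, habc, ha, hb, hcc, hle⟩ := hH.exists_card_le_tripartitePlus
      (isBlowFree_of_not_hasCopy ht hH hc) hκ (by rwa [Fintype.card_fin])
      (by rwa [Fintype.card_fin]) (by rwa [Fintype.card_fin])
    rw [Fintype.card_fin] at habc ha hb hcc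
    rw [← hcard]
    exact hle.trans (hn1 (n + 1) (by omega) a b c habc ha hb hcc)
  · right
    push Not at hdeg
    obtain ⟨v, hv⟩ := hdeg
    have h1 := exThree_succ_le h3 hc v
    rw [hcard] at h1
    rw [hH.linkCount_univ] at hv
    push_cast at hv
    have h2 : (H.filter (v ∈ ·)).card + 1 ≤ (n / 3) ^ 2 := by
      have h4 : (n : ℝ) ≤ 3 * ((n / 3 : ℕ) : ℝ) + 2 := by
        exact_mod_cast (by omega : n ≤ 3 * (n / 3) + 2)
      have h5 : (((H.filter (v ∈ ·)).card + 1 : ℕ) : ℝ) ≤ (((n / 3) ^ 2 : ℕ) : ℝ) := by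
        push_cast at hN hN' ⊢
        set d : ℝ := ((n / 3 : ℕ) : ℝ)
        have h6 : ((n : ℝ) + 1) ^ 2 ≤ 9 * d ^ 2 + 6 * (n + 1) := by nlinarith
        have h7 : 40000 * ((n : ℝ) + 1) ≤ κ ^ 2 * (n + 1) ^ 2 := by nlinarith
        nlinarith
      exact_mod_cast h5
    omega

end ProgressiveInduction

theorem statement10 (t : ℕ) (ht : 1 ≤ t) :
    ∃ n0 : ℕ, ∀ n : ℕ, n ≥ n0 → exThree n (F5b3 t) = eT3plus n t := by
  obtain ⟨m, hm⟩ := exists_exThree_drop t ht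
  have hle := fun n => eT3plus_le_exThree n t ht
  obtain ⟨k, hk⟩ := eventually_eq_zero_of_drop
    (φ := fun n => exThree n (F5b3 t) - eT3plus n t) (m := m) fun n hn => by
      have h1 := hm n hn
      have h2 := eT3plus_add_sq_le n t
      have h3 := hle n
      have h4 := hle (n + 1)
      omega
  refine ⟨k, fun n hn => ?_⟩
  have h1 := hk n hn
  have h2 := hle n
  omega
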